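/- Let G be a bridgeless graph and C a cycle of G such that no CDC of G contains C, and suppose the pair (G, C) is a minimal counterexample to the strong cycle double cover conjecture, i.e. for every bridgeless graph H with |V(H)| < |V(G)|, or with |V(H)| = |V(G)| and |E(H)| < |E(G)|, every cycle of H is contained in some CDC of H. Then G is a snark and C is a stable cycle of G. -/

import Mathlib

open scoped Classical

namespace SnarkPaper

variable {V : Type*}

/-- A graph is cubic if every vertex has exactly 3 neighbours. -/
def IsCubic (G : SimpleGraph V) : Prop := ∀ v : V, (G.neighborSet v).ncard = 3

/-- A proper 3-edge-colouring: edges sharing an endpoint get different colours. -/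
def Colourable3 (G : SimpleGraph V) : Prop :=
  ∃ c : Sym2 V → Fin 3, ∀ e₁ ∈ G.edgeSet, ∀ e₂ ∈ G.edgeSet,
    e₁ ≠ e₂ → (∃ v, v ∈ e₁ ∧ v ∈ e₂) → c e₁ ≠ c e₂

/-- A subgraph is 2-regular if every one of its vertices has exactly two neighbours in it. -/
def IsTwoRegular {G : SimpleGraph V} (H : G.Subgraph) : Prop :=
  ∀ v ∈ H.verts, (H.neighborSet v).ncard = 2

/-- A cycle is a connected 2-regular subgraph. -/
def IsCycleSub {G : SimpleGraph V} (C : G.Subgraph) : Prop :=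
  C.Connected ∧ IsTwoRegular C

/-- A 2-factor is a spanning 2-regular subgraph. -/
def IsTwoFactor {G : SimpleGraph V} (F : G.Subgraph) : Prop :=
  F.IsSpanning ∧ IsTwoRegular F

/-- A 2-factor is even if all its cycles (connected components) have even length. -/
def IsEvenTwoFactor {G : SimpleGraph V} (F : G.Subgraph) : Prop :=
  IsTwoFactor F ∧ ∀ C : G.Subgraph, C ≤ F → IsCycleSub C → Even C.verts.ncard

/-- An even subgraph: every vertex has even degree. -/
def IsEvenSubgraph {G : SimpleGraph V} (H : G.Subgraph) : Prop :=
  ∀ v : V, Even (H.neighborSet v).ncard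

/-- A cycle double cover: a multiset of cycles covering each edge exactly twice. -/
def IsCDC (G : SimpleGraph V) (D : Multiset G.Subgraph) : Prop :=
  (∀ C ∈ D, IsCycleSub C) ∧
  ∀ e ∈ G.edgeSet, D.countP (fun C => e ∈ C.edgeSet) = 2

/-- A k-CDC, seen as a multiset of k even subgraphs covering each edge exactly twice. -/
def IsKCDC (G : SimpleGraph V) (k : ℕ) (D : Multiset G.Subgraph) : Prop :=
  D.card = k ∧ (∀ H ∈ D, IsEvenSubgraph H) ∧
  ∀ e ∈ G.edgeSet, D.countP (fun H => e ∈ H.edgeSet) = 2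

/-- An edge set is even if every vertex meets an even number of its edges. -/
def EvenEdgeSet (S : Set (Sym2 V)) : Prop :=
  ∀ v : V, Even {w : V | s(v, w) ∈ S}.ncard

/-- A k-CDC presented as a multiset of k even edge sets covering each edge exactly twice. -/
def IsKCDCEdgeSets (G : SimpleGraph V) (k : ℕ) (D : Multiset (Set (Sym2 V))) : Prop :=
  D.card = k ∧ (∀ S ∈ D, S ⊆ G.edgeSet ∧ EvenEdgeSet S) ∧
  ∀ e ∈ G.edgeSet, D.countP (fun S => e ∈ S) = 2

/-- The set A contains (the vertices of) a cycle of G. -/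
def HasCycleIn (G : SimpleGraph V) (A : Set V) : Prop :=
  ∃ C : G.Subgraph, IsCycleSub C ∧ C.verts ⊆ A

/-- The edges of G crossing between A and its complement. -/
def cutEdges (G : SimpleGraph V) (A : Set V) : Set (Sym2 V) :=
  {e ∈ G.edgeSet | ∃ x ∈ A, ∃ y ∉ A, e = s(x, y)}

/-- Cyclically k-edge-connected: every edge cut separating two cycles has at least k edges. -/
def CyclEdgeConn (G : SimpleGraph V) (k : ℕ) : Prop :=
  ∀ A : Set V, HasCycleIn G A → HasCycleIn G Aᶜ → k ≤ (cutEdges G A).ncard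

/-- A snark: an uncolourable cyclically 4-edge-connected cubic graph with girth at least 5. -/
def IsSnark (G : SimpleGraph V) : Prop :=
  IsCubic G ∧ ¬ Colourable3 G ∧ CyclEdgeConn G 4 ∧ 5 ≤ G.girth

/-- The edge-insertion operation applied to the edges ab and cd of G: subdivide each with a
new vertex (u = inr 0, v = inr 1) and join the two new vertices by an edge. -/
def edgeInsertion (G : SimpleGraph V) (a b c d : V) : SimpleGraph (V ⊕ Fin 2) :=
  SimpleGraph.fromEdgeSet
    ((Sym2.map Sum.inl '' (G.edgeSet \ {s(a, b), s(c, d)})) ∪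
      {s(Sum.inl a, Sum.inr 0), s(Sum.inr 0, Sum.inl b),
       s(Sum.inl c, Sum.inr 1), s(Sum.inr 1, Sum.inl d),
       s(Sum.inr 0, Sum.inr 1)})

/-- A permutation graph: a cubic graph with a 2-factor consisting of two induced cycles. -/
def IsPermutationGraph (G : SimpleGraph V) : Prop :=
  IsCubic G ∧ ∃ C₁ C₂ : G.Subgraph, IsCycleSub C₁ ∧ IsCycleSub C₂ ∧
    C₁.IsInduced ∧ C₂.IsInduced ∧ Disjoint C₁.verts C₂.verts ∧ IsTwoFactor (C₁ ⊔ C₂)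

/-- The total weight of the edge cut determined by A. -/
noncomputable def cutWeight (G : SimpleGraph V) (w : Sym2 V → ℕ) (A : Set V) : ℕ :=
  ∑ᶠ e ∈ cutEdges G A, w e

/-- An eulerian (1,2)-weight: each edge gets weight 1 or 2 and every edge cut has even weight. -/
def IsEulerianWeight (G : SimpleGraph V) (w : Sym2 V → ℕ) : Prop :=
  (∀ e ∈ G.edgeSet, w e = 1 ∨ w e = 2) ∧ ∀ A : Set V, Even (cutWeight G w A)

/-- A compatible cycle cover of (G, w): each edge e lies in exactly w(e) of the cycles. -/
def IsCompatibleCycleCover (G : SimpleGraph V) (w : Sym2 V → ℕ)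
    (D : Multiset G.Subgraph) : Prop :=
  (∀ C ∈ D, IsCycleSub C) ∧
  ∀ e ∈ G.edgeSet, D.countP (fun C => e ∈ C.edgeSet) = w e


open scoped symmDiff
set_option linter.unusedSectionVars false
set_option linter.unusedSimpArgs false
set_option linter.unnecessarySimpa false

/-- A multigraph: edges are labelled by elements of `F`, `E` is the set of edges present. -/
structure MG (W F : Type) where
  s : F → W
  t : F → W
  E : Set F

namespace MG
variable {W F : Type} [Fintype W] [Fintype F]

/-- labels crossing the boundary of `A` -/
def cr (M : MG W F) (A : Set W) : Set F := {e | ¬ (M.s e ∈ A ↔ M.t e ∈ A)}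

def cut (M : MG W F) (A : Set W) : Set F := M.E ∩ M.cr A

def Ev (M : MG W F) (T : Set F) : Prop := ∀ v, Even (T ∩ M.cr {v}).ncard

def Circ (M : MG W F) (C : Set F) : Prop :=
  C ⊆ M.E ∧ M.Ev C ∧ ∀ T, T ⊆ C → M.Ev T → T = ∅ ∨ T = C

noncomputable def cov (D : Multiset (Set F)) (e : F) : ℕ := D.countP (fun T => e ∈ T)

def Good (M : MG W F) (C : Set F) : Prop :=
  ∃ D : Multiset (Set F), (∀ T ∈ D, T ⊆ M.E ∧ M.Ev T) ∧
    ∀ e ∈ M.E, cov D e + (if e ∈ C then 1 else 0) = 2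

def Brl (M : MG W F) : Prop := ∀ A : Set W, A.Nonempty → Aᶜ.Nonempty → 2 ≤ (M.cut A).ncard

def Lpl (M : MG W F) : Prop := ∀ e ∈ M.E, M.s e ≠ M.t e

def ends (M : MG W F) (e : F) : Sym2 W := s(M.s e, M.t e)

@[simp] lemma cov_zero (e : F) : cov (0 : Multiset (Set F)) e = 0 := by simp [cov]
@[simp] lemma cov_cons (T : Set F) (D : Multiset (Set F)) (e : F) :
    cov (T ::ₘ D) e = cov D e + (if e ∈ T then 1 else 0) := by
  simp [cov, Multiset.countP_cons]
@[simp] lemma cov_add (D D' : Multiset (Set F)) (e : F) :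
    cov (D + D') e = cov D e + cov D' e := by
  simp [cov]

lemma mem_cr {M : MG W F} {A : Set W} {e : F} : e ∈ M.cr A ↔ ¬ (M.s e ∈ A ↔ M.t e ∈ A) := Iff.rfl

lemma cr_compl (M : MG W F) (A : Set W) : M.cr Aᶜ = M.cr A := by
  ext e; simp only [mem_cr, Set.mem_compl_iff]; tauto

lemma cut_compl (M : MG W F) (A : Set W) : M.cut Aᶜ = M.cut A := by
  simp [cut, cr_compl]

/-- parity of the boundary -/
noncomputable def par (M : MG W F) (T : Set F) (A : Set W) : ZMod 2 := ((T ∩ M.cr A).ncard : ZMod 2)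

lemma ncard_eq_sum (S : Set F) : (S.ncard : ZMod 2) = ∑ e : F, if e ∈ S then 1 else 0 := by
  rw [Set.ncard_eq_toFinset_card']
  simp

lemma par_eq (M : MG W F) (T : Set F) (A : Set W) :
    M.par T A = ∑ e : F, if e ∈ T then
      ((if M.s e ∈ A then 1 else 0) + (if M.t e ∈ A then 1 else 0) : ZMod 2) else 0 := by
  rw [par, ncard_eq_sum]
  apply Finset.sum_congr rfl
  intro e _
  have h11 : (1 + 1 : ZMod 2) = 0 := by decide
  by_cases h1 : e ∈ T <;> by_cases h2 : M.s e ∈ A <;> by_cases h3 : M.t e ∈ A <;>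
    simp [h1, h2, h3, mem_cr, h11]

lemma par_eq_zero (M : MG W F) (T : Set F) (A : Set W) :
    M.par T A = 0 ↔ Even (T ∩ M.cr A).ncard := by
  rw [par, ZMod.natCast_eq_zero_iff_even]

lemma ev_iff (M : MG W F) (T : Set F) : M.Ev T ↔ ∀ v, M.par T {v} = 0 := by
  simp [Ev, par_eq_zero]

lemma par_symmDiff (M : MG W F) (S T : Set F) (A : Set W) :
    M.par (S ∆ T) A = M.par S A + M.par T A := by
  simp only [par_eq, ← Finset.sum_add_distrib]
  apply Finset.sum_congr rfl
  intro e _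
  have h11 : ∀ x : ZMod 2, x + x = 0 := by decide
  by_cases h1 : e ∈ S <;> by_cases h2 : e ∈ T <;> simp [h1, h2, Set.mem_symmDiff, h11]

lemma par_sum (M : MG W F) (T : Set F) (A : Set W) :
    M.par T A = ∑ v : W, if v ∈ A then M.par T {v} else 0 := by
  have : ∀ v : W, (if v ∈ A then M.par T {v} else 0) = ∑ e : F, if e ∈ T then
      ((if M.s e = v ∧ v ∈ A then 1 else 0) + (if M.t e = v ∧ v ∈ A then 1 else 0) : ZMod 2) else 0 := by
    intro v
    by_cases h : v ∈ A <;> simp [h, par_eq]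
  simp only [this]
  rw [Finset.sum_comm, par_eq]
  apply Finset.sum_congr rfl
  intro e _
  by_cases h : e ∈ T
  · simp only [h, if_true, Finset.sum_add_distrib]
    congr 1
    · rw [Finset.sum_eq_single (M.s e)] <;> simp +contextual [eq_comm]
    · rw [Finset.sum_eq_single (M.t e)] <;> simp +contextual [eq_comm]
  · simp [h]

lemma par_of_even (M : MG W F) {T : Set F} {A : Set W} (h : ∀ v ∈ A, M.par T {v} = 0) :
    M.par T A = 0 := by
  rw [par_sum]
  apply Finset.sum_eq_zero
  intro v _
  split_ifs with hv
  · exact h v hv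
  · rfl

lemma Ev.cut {M : MG W F} {T : Set F} (h : M.Ev T) (A : Set W) : Even (T ∩ M.cr A).ncard := by
  rw [← par_eq_zero]
  exact M.par_of_even fun v _ => (M.ev_iff T).1 h v

lemma Ev.symmDiff {M : MG W F} {S T : Set F} (hS : M.Ev S) (hT : M.Ev T) : M.Ev (S ∆ T) := by
  rw [ev_iff] at *
  intro v
  rw [par_symmDiff, hS, hT, add_zero]

lemma ev_empty (M : MG W F) : M.Ev ∅ := by intro v; simp

lemma sdiff_eq_symmDiff {S T : Set F} (h : T ⊆ S) : S \ T = S ∆ T := by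
  ext e; simp only [Set.mem_sdiff, Set.mem_symmDiff]
  have := @h e
  tauto

lemma Ev.sdiff {M : MG W F} {S T : Set F} (hS : M.Ev S) (hT : M.Ev T) (h : T ⊆ S) : M.Ev (S \ T) := by
  rw [sdiff_eq_symmDiff h]; exact hS.symmDiff hT

/-- deg three incidence gives a propositional parity statement -/
lemma even_triple {T : Set F} {K E : Set F} {a b c : F} (hTE : T ⊆ E) (hK : E ∩ K = {a, b, c})
    (hab : a ≠ b) (hac : a ≠ c) (hbc : b ≠ c) :
    Even (T ∩ K).ncard ↔ ((a ∈ T ∧ b ∈ T ∧ c ∉ T) ∨ (a ∈ T ∧ b ∉ T ∧ c ∈ T) ∨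
      (a ∉ T ∧ b ∈ T ∧ c ∈ T) ∨ (a ∉ T ∧ b ∉ T ∧ c ∉ T)) := by
  have h0 : T ∩ K = T ∩ {a, b, c} := by
    rw [← hK, ← Set.inter_assoc, Set.inter_eq_left.2 hTE]
  have key : ((T ∩ {a, b, c}).ncard : ZMod 2) = (if a ∈ T then 1 else 0) + (if b ∈ T then 1 else 0)
      + (if c ∈ T then 1 else 0) := by
    rw [ncard_eq_sum]
    trans ∑ e : F, ((if e = a then (if a ∈ T then 1 else 0) else 0) + (if e = b then (if b ∈ T then 1 else 0) else 0)
      + (if e = c then (if c ∈ T then 1 else 0) else 0) : ZMod 2)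
    · apply Finset.sum_congr rfl
      intro e _
      by_cases h1 : e = a
      · subst h1; simp [hab, hac]
      · by_cases h2 : e = b
        · subst h2; simp [hab.symm, hbc]
        · by_cases h3 : e = c
          · subst h3; simp [hac.symm, hbc.symm]
          · simp [h1, h2, h3]
    · simp only [Finset.sum_add_distrib, Finset.sum_ite_eq', Finset.mem_univ, if_true]
  rw [h0, ← ZMod.natCast_eq_zero_iff_even, key]
  have h11 : (1 + 1 : ZMod 2) = 0 := by decide
  by_cases h1 : a ∈ T <;> by_cases h2 : b ∈ T <;> by_cases h3 : c ∈ T <;> simp [h1, h2, h3, h11]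

/-- The chosen-element lemma -/
lemma cov_pos {D : Multiset (Set F)} {e : F} (h : 0 < cov D e) : ∃ X D', D = X ::ₘ D' ∧ e ∈ X := by
  obtain ⟨X, hX, he⟩ := Multiset.countP_pos.1 h
  obtain ⟨D', rfl⟩ := Multiset.exists_cons_of_mem hX
  exact ⟨X, D', rfl, he⟩

lemma cov_zero_iff {D : Multiset (Set F)} {e : F} : cov D e = 0 ↔ ∀ X ∈ D, e ∉ X := by
  simp [cov, Multiset.countP_eq_zero]

/-- connectivity inside T via parity -/
def Rch (M : MG W F) (T : Set F) : W → W → Prop :=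
  Relation.ReflTransGen (fun x y => ∃ e ∈ T, (M.s e = x ∧ M.t e = y) ∨ (M.s e = y ∧ M.t e = x))

lemma par_single (M : MG W F) (e : F) (A : Set W) :
    M.par {e} A = (if M.s e ∈ A then 1 else 0) + (if M.t e ∈ A then 1 else 0) := by
  rw [par_eq, Finset.sum_eq_single e] <;> simp +contextual

lemma par_single' (M : MG W F) (e : F) (v : W) :
    M.par {e} {v} = (if v = M.s e then 1 else 0) + (if v = M.t e then 1 else 0) := by
  rw [par_single]
  congr 1 <;> simp [eq_comm]

lemma Rch.join {M : MG W F} {T : Set F} {x y : W} (h : M.Rch T x y) :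
    ∃ P ⊆ T, ∀ v, M.par P {v} = (if v = x then 1 else 0) + (if v = y then 1 else 0) := by
  have h11 : ∀ x : ZMod 2, x + x = 0 := by decide
  induction h with
  | refl => exact ⟨∅, by simp, by intro v; simp [par, h11]⟩
  | @tail y z _ hyz ih =>
    obtain ⟨P, hPT, hP⟩ := ih
    obtain ⟨e, he, hse⟩ := hyz
    refine ⟨P ∆ {e}, ?_, ?_⟩
    · intro f hf
      rcases hf with hf | hf
      · exact hPT hf.1
      · have := hf.1; simp at this; subst this; exact he
    · intro v
      rw [par_symmDiff, hP, par_single']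
      have h2 : ((if v = M.s e then 1 else 0) + (if v = M.t e then 1 else 0) : ZMod 2)
        = (if v = y then 1 else 0) + (if v = z then 1 else 0) := by
        rcases hse with ⟨h1, h2⟩ | ⟨h1, h2⟩
        · simp [h1, h2]
        · rw [add_comm]; simp [h1, h2]
      rw [h2]
      generalize (if v = x then (1 : ZMod 2) else 0) = p
      generalize (if v = y then (1 : ZMod 2) else 0) = q
      generalize (if v = z then (1 : ZMod 2) else 0) = r
      revert p q r; decide

lemma Rch.not_cr {M : MG W F} {T : Set F} {x : W} {e : F} (he : e ∈ T) : e ∉ M.cr {y | M.Rch T x y} := by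
  rw [mem_cr, not_not]
  constructor
  · intro h; exact Relation.ReflTransGen.tail h ⟨e, he, Or.inl ⟨rfl, rfl⟩⟩
  · intro h; exact Relation.ReflTransGen.tail h ⟨e, he, Or.inr ⟨rfl, rfl⟩⟩

lemma Rch.exists_odd {M : MG W F} {T : Set F} {x : W} (hx : M.par T {x} ≠ 0) :
    ∃ y, y ≠ x ∧ M.par T {y} ≠ 0 ∧ M.Rch T x y := by
  by_contra hcon
  push Not at hcon
  have h0 : M.par T {y | M.Rch T x y} = 0 := by
    have : T ∩ M.cr {y | M.Rch T x y} = ∅ := by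
      ext e; simp only [Set.mem_inter_iff, Set.mem_empty_iff_false, iff_false, not_and]
      exact fun he => Rch.not_cr he
    simp [par, this]
  rw [par_sum, Finset.sum_eq_single x] at h0
  · have : M.Rch T x x := Relation.ReflTransGen.refl
    simp [this] at h0
    exact hx h0
  · intro y _ hy
    split_ifs with h
    · by_contra h3; exact hcon y hy h3 h
    · rfl
  · simp

end MG

namespace MG
variable {W F : Type} [Fintype W] [Fintype F]

structure Rep (M : MG W F) (H : SimpleGraph W) : Prop where
  inj : Set.InjOn M.ends M.E
  img : ∀ x y, H.Adj x y ↔ ∃ e ∈ M.E, M.ends e = s(x, y)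

lemma Rep.lpl {M : MG W F} {H : SimpleGraph W} (h : Rep M H) : M.Lpl := by
  intro e he hst
  have := (h.img (M.s e) (M.t e)).2 ⟨e, he, rfl⟩
  exact this.ne hst

lemma mem_cr_single {M : MG W F} {e : F} (h : M.s e ≠ M.t e) (v : W) :
    e ∈ M.cr {v} ↔ v ∈ M.ends e := by
  simp only [mem_cr, ends, Sym2.mem_iff, Set.mem_singleton_iff]
  constructor
  · intro h; by_contra h2; push Not at h2; exact h (by simp [h2.1.symm, h2.2.symm])
  · rintro (rfl | rfl)
    · simp [h.symm]
    · simp [h]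

lemma mem_cr_ends {M : MG W F} {e : F} {A : Set W} {x y : W} (h : M.ends e = s(x, y)) :
    e ∈ M.cr A ↔ ¬ (x ∈ A ↔ y ∈ A) := by
  rw [mem_cr]
  rcases Sym2.eq_iff.1 h with ⟨h1, h2⟩ | ⟨h1, h2⟩ <;> rw [h1, h2]
  tauto

def edgesOf (M : MG W F) {H : SimpleGraph W} (K : H.Subgraph) : Set F :=
  {e ∈ M.E | M.ends e ∈ K.edgeSet}

lemma Rep.deg {M : MG W F} {H : SimpleGraph W} (h : Rep M H) (K : H.Subgraph) (v : W) :
    (M.edgesOf K ∩ M.cr {v}).ncard = (K.neighborSet v).ncard := by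
  have hinj : Set.InjOn M.ends (M.edgesOf K ∩ M.cr {v}) := h.inj.mono fun e he => he.1.1
  rw [← hinj.ncard_image]
  rw [← Set.ncard_image_of_injective (K.neighborSet v) (f := fun w => s(v, w))
    (by intro a b hab; have := hab; simp at this; rcases this with h | ⟨h, h'⟩; exacts [h, h'.trans h])]
  congr 1
  ext z
  constructor
  · rintro ⟨e, ⟨⟨heE, heK⟩, hc⟩, rfl⟩
    rw [mem_cr_single (h.lpl e heE)] at hc
    obtain ⟨w, hw⟩ := hc
    rw [hw] at heK ⊢
    exact ⟨w, heK, rfl⟩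
  · rintro ⟨w, hw, rfl⟩
    have hadj : K.Adj v w := hw
    obtain ⟨e, he, hee⟩ := (h.img v w).1 hadj.adj_sub
    refine ⟨e, ⟨⟨he, ?_⟩, ?_⟩, hee⟩
    · rw [hee]; exact hadj
    · rw [mem_cr_single (h.lpl e he), hee]; simp

lemma Rep.ev {M : MG W F} {H : SimpleGraph W} (h : Rep M H) {K : H.Subgraph}
    (hK : IsTwoRegular K) : M.Ev (M.edgesOf K) := by
  intro v
  rw [h.deg]
  by_cases hv : v ∈ K.verts
  · rw [hK v hv]; exact even_two
  · have : K.neighborSet v = ∅ := by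
      ext w; simp only [Set.mem_empty_iff_false, iff_false]
      intro hw; exact hv (K.edge_vert hw)
    simp [this]

lemma Rep.deg_top {M : MG W F} {H : SimpleGraph W} (h : Rep M H) (v : W) :
    (M.cut {v}).ncard = (H.neighborSet v).ncard := by
  have h1 := h.deg (⊤ : H.Subgraph) v
  have h2 : M.edgesOf (⊤ : H.Subgraph) = M.E := by
    ext e; simp only [edgesOf, Set.mem_ofPred_eq, and_iff_left_iff_imp]
    intro he
    exact (h.img _ _).2 ⟨e, he, rfl⟩
  rw [h2] at h1
  simpa [cut] using h1

lemma isCycleSub_of_isCycle {H : SimpleGraph W} {u : W} {p : H.Walk u u} (hp : p.IsCycle) :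
    IsCycleSub p.toSubgraph :=
  ⟨p.toSubgraph_connected, fun v hv =>
    hp.ncard_neighborSet_toSubgraph_eq_two ((SimpleGraph.Walk.mem_verts_toSubgraph _).1 hv)⟩

lemma Rep.cyc_in {M : MG W F} {H : SimpleGraph W} (h : Rep M H) {T : Set F} (hTE : T ⊆ M.E)
    (hT : M.Ev T) {e0 : F} (he0 : e0 ∈ T) :
    ∃ P : H.Subgraph, IsCycleSub P ∧ M.edgesOf P ⊆ T ∧ e0 ∈ M.edgesOf P := by
  set H' : SimpleGraph W := SimpleGraph.fromEdgeSet (M.ends '' (T \ {e0})) with hH'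
  have hadj : ∀ {x y}, H'.Adj x y ↔ s(x, y) ∈ M.ends '' (T \ {e0}) ∧ x ≠ y := by
    intro x y; simp [hH', SimpleGraph.fromEdgeSet_adj]
  have hle : H' ≤ H := by
    intro x y hxy
    obtain ⟨⟨e, he, hee⟩, _⟩ := hadj.1 hxy
    exact (h.img x y).2 ⟨e, hTE he.1, hee⟩
  have hreach : H'.Reachable (M.s e0) (M.t e0) := by
    by_contra hn
    have h1 : T ∩ M.cr {v | H'.Reachable (M.s e0) v} = {e0} := by
      ext e
      simp only [Set.mem_inter_iff, Set.mem_singleton_iff]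
      constructor
      · rintro ⟨he, hc⟩
        by_contra hne
        have hA : H'.Adj (M.s e) (M.t e) := hadj.2 ⟨⟨e, ⟨he, hne⟩, rfl⟩, h.lpl e (hTE he)⟩
        rw [mem_cr] at hc
        exact hc ⟨fun h1 => SimpleGraph.Reachable.trans h1 hA.reachable,
          fun h1 => SimpleGraph.Reachable.trans h1 hA.reachable.symm⟩
      · rintro rfl
        refine ⟨he0, ?_⟩
        rw [mem_cr]
        simp only [Set.mem_ofPred_eq, SimpleGraph.Reachable.refl, true_iff]
        exact hn
    have h2 := hT.cut {v | H'.Reachable (M.s e0) v}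
    rw [h1] at h2
    simp at h2
  obtain ⟨p, hp⟩ := hreach.exists_isPath
  have hA : H.Adj (M.t e0) (M.s e0) := ((h.img _ _).2 ⟨e0, hTE he0, rfl⟩).symm
  have hpe : ∀ z ∈ p.edges, z ∈ M.ends '' (T \ {e0}) := by
    intro z hz
    have := p.edges_subset_edgeSet hz
    rw [hH', SimpleGraph.edgeSet_fromEdgeSet] at this
    exact this.1
  have hcyc : (SimpleGraph.Walk.cons hA (p.mapLe hle)).IsCycle := by
    rw [SimpleGraph.Walk.cons_isCycle_iff]
    refine ⟨(SimpleGraph.Walk.isPath_mapLe hle).2 hp, ?_⟩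
    simp only [SimpleGraph.Walk.edges_mapLe_eq_edges]
    intro hz
    obtain ⟨e, he, hee⟩ := hpe _ hz
    rw [Sym2.eq_swap] at hee
    exact he.2 (h.inj (hTE he.1) (hTE he0) hee)
  refine ⟨_, isCycleSub_of_isCycle hcyc, ?_, ?_⟩
  · rintro e ⟨heE, he⟩
    rw [SimpleGraph.Walk.mem_edges_toSubgraph, SimpleGraph.Walk.edges_cons,
      SimpleGraph.Walk.edges_mapLe_eq_edges, List.mem_cons] at he
    rcases he with he | he
    · rw [Sym2.eq_swap] at he
      rw [h.inj heE (hTE he0) he]; exact he0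
    · obtain ⟨f, hf, hfe⟩ := hpe _ he
      rw [h.inj heE (hTE hf.1) hfe.symm]; exact hf.1
  · refine ⟨hTE he0, ?_⟩
    rw [SimpleGraph.Walk.mem_edges_toSubgraph, SimpleGraph.Walk.edges_cons, List.mem_cons]
    left; rw [Sym2.eq_swap]; rfl

lemma Rep.circ {M : MG W F} {H : SimpleGraph W} (h : Rep M H) {K : H.Subgraph}
    (hK : IsCycleSub K) : M.Circ (M.edgesOf K) := by
  refine ⟨fun e he => he.1, h.ev hK.2, ?_⟩
  intro T hTK hT
  by_contra hcon
  push Not at hcon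
  obtain ⟨hne, hneq⟩ := hcon
  have hfull : ∀ v, (T ∩ M.cr {v}).Nonempty → M.edgesOf K ∩ M.cr {v} ⊆ T := by
    intro v hv
    have hsub : T ∩ M.cr {v} ⊆ M.edgesOf K ∩ M.cr {v} := Set.inter_subset_inter_left _ hTK
    have hKv : (M.edgesOf K ∩ M.cr {v}).ncard ≤ 2 := by
      rw [h.deg]
      by_cases hv : v ∈ K.verts
      · rw [hK.2 v hv]
      · have : K.neighborSet v = ∅ := by
          ext w; simp only [Set.mem_empty_iff_false, iff_false]
          intro hw; exact hv (K.edge_vert hw)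
        simp [this]
    have h1 : 0 < (T ∩ M.cr {v}).ncard := (Set.ncard_pos).2 hv
    have h2 := hT v
    have h3 : 2 ≤ (T ∩ M.cr {v}).ncard := by
      obtain ⟨k, hk⟩ := h2; omega
    have := Set.eq_of_subset_of_ncard_le hsub (by omega)
    rw [← this]; exact Set.inter_subset_left
  obtain ⟨e1, he1⟩ := hne
  have hmemcr : ∀ e ∈ M.edgesOf K, ∀ v, v ∈ M.ends e → e ∈ M.cr {v} := fun e he v hv =>
    (mem_cr_single (h.lpl e he.1) v).2 hv
  -- all vertices of K are touched
  have hall : ∀ v ∈ K.verts, (T ∩ M.cr {v}).Nonempty := by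
    have hs1 : M.s e1 ∈ K.verts := K.edge_vert (show K.Adj (M.s e1) (M.t e1) from (hTK he1).2)
    have hconn := hK.1
    intro v hv
    by_contra hnv
    obtain ⟨p⟩ := hconn.preconnected ⟨M.s e1, hs1⟩ ⟨v, hv⟩
    obtain ⟨d, _, hd1, hd2⟩ := p.exists_boundary_dart {w | (T ∩ M.cr {(w : W)}).Nonempty}
      ⟨e1, he1, hmemcr e1 (hTK he1) _ (by simp [ends])⟩ hnv
    apply hd2
    have had : K.Adj d.fst d.snd := d.adj
    obtain ⟨e, he, hee⟩ := (h.img _ _).1 had.adj_sub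
    have heK : e ∈ M.edgesOf K := ⟨he, by rw [hee]; exact had⟩
    exact ⟨e, hfull _ hd1 ⟨heK, hmemcr e heK _ (by rw [hee]; simp)⟩, hmemcr e heK _ (by rw [hee]; simp)⟩
  apply hneq
  apply Set.Subset.antisymm hTK
  intro e he
  have hs1 : M.s e ∈ K.verts := K.edge_vert (show K.Adj (M.s e) (M.t e) from he.2)
  exact hfull _ (hall _ hs1) ⟨he, hmemcr e he _ (by simp [ends])⟩

/-- decomposition of even sets into cycles -/
lemma Rep.decomp {M : MG W F} {H : SimpleGraph W} (h : Rep M H) (n : ℕ) : ∀ T : Set F, T.ncard ≤ n →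
    T ⊆ M.E → M.Ev T → ∃ D : Multiset H.Subgraph, (∀ K ∈ D, IsCycleSub K) ∧
      ∀ e ∈ M.E, D.countP (fun K => M.ends e ∈ K.edgeSet) = if e ∈ T then 1 else 0 := by
  induction n with
  | zero =>
    intro T hn _ _
    have : T = ∅ := by rw [← Set.ncard_eq_zero]; omega
    subst this
    exact ⟨0, by simp, by simp⟩
  | succ n ih =>
    intro T hn hTE hT
    by_cases hne : T = ∅
    · subst hne; exact ⟨0, by simp, by simp⟩
    · obtain ⟨e0, he0⟩ := Set.nonempty_iff_ne_empty.2 hne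
      obtain ⟨P, hP, hPT, he0P⟩ := h.cyc_in hTE hT he0
      have hlt : (T \ M.edgesOf P).ncard < T.ncard := by
        exact Set.ncard_lt_ncard ⟨Set.sdiff_subset, fun hs => (hs he0).2 he0P⟩ (Set.toFinite _)
      obtain ⟨D, hD, hcov⟩ := ih (T \ M.edgesOf P) (by omega) (Set.sdiff_subset.trans hTE)
        (hT.sdiff (h.ev hP.2) hPT)
      refine ⟨P ::ₘ D, ?_, ?_⟩
      · intro K hK
        rcases Multiset.mem_cons.1 hK with rfl | hK
        · exact hP
        · exact hD K hK
      · intro e he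
        rw [Multiset.countP_cons, hcov e he]
        have h1 : M.ends e ∈ P.edgeSet ↔ e ∈ M.edgesOf P := ⟨fun h => ⟨he, h⟩, fun h => h.2⟩
        have h2 := @hPT e
        by_cases h3 : e ∈ M.edgesOf P <;> by_cases h4 : e ∈ T <;> simp_all

lemma Rep.cdc_of_good {M : MG W F} {H : SimpleGraph W} (h : Rep M H) {K : H.Subgraph}
    (hK : IsCycleSub K) (hg : M.Good (M.edgesOf K)) :
    ∃ D : Multiset H.Subgraph, IsCDC H D ∧ K ∈ D := by
  obtain ⟨D, hD, hcov⟩ := hg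
  have key : ∀ D : Multiset (Set F), (∀ T ∈ D, T ⊆ M.E ∧ M.Ev T) →
      ∃ D' : Multiset H.Subgraph, (∀ K ∈ D', IsCycleSub K) ∧
      ∀ e ∈ M.E, D'.countP (fun K => M.ends e ∈ K.edgeSet) = cov D e := by
    intro D
    induction D using Multiset.induction_on with
    | empty => intro _; exact ⟨0, by simp, by simp⟩
    | cons T D ih =>
      intro hD
      obtain ⟨D1, h1, h2⟩ := ih fun T hT => hD T (Multiset.mem_cons_of_mem hT)
      obtain ⟨hTE, hTev⟩ := hD T (Multiset.mem_cons_self _ _)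
      obtain ⟨D2, h3, h4⟩ := h.decomp _ T le_rfl hTE hTev
      refine ⟨D1 + D2, ?_, ?_⟩
      · intro K hK
        rcases Multiset.mem_add.1 hK with hK | hK
        · exact h1 K hK
        · exact h3 K hK
      · intro e he
        rw [Multiset.countP_add, h2 e he, h4 e he, cov_cons]
  obtain ⟨D', h1, h2⟩ := key D hD
  refine ⟨K ::ₘ D', ⟨?_, ?_⟩, Multiset.mem_cons_self _ _⟩
  · intro K' hK'
    rcases Multiset.mem_cons.1 hK' with rfl | hK'
    · exact hK
    · exact h1 K' hK'
  · intro z hz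
    induction z using Sym2.ind with
    | _ x y =>
    obtain ⟨e, he, hee⟩ := (h.img x y).1 hz
    have h3 := h2 e he
    rw [hee] at h3
    have h4 := hcov e he
    have h5 : s(x, y) ∈ K.edgeSet ↔ e ∈ M.edgesOf K := by
      rw [← hee]; exact ⟨fun h => ⟨he, h⟩, fun h => h.2⟩
    rw [Multiset.countP_cons]
    have h6 : D'.countP (fun K => s(x, y) ∈ K.edgeSet) = cov D e := by convert h3
    rw [h6, ← h4]
    by_cases h7 : e ∈ M.edgesOf K <;> simp [h5, h7]

lemma Rep.cov_map {M : MG W F} {H : SimpleGraph W} (h : Rep M H) (D : Multiset H.Subgraph)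
    {e : F} (he : e ∈ M.E) :
    cov (D.map M.edgesOf) e = D.countP (fun K => M.ends e ∈ K.edgeSet) := by
  induction D using Multiset.induction_on with
  | empty => simp
  | cons K D ih =>
    rw [Multiset.map_cons, cov_cons, ih, Multiset.countP_cons]
    congr 1
    have h1 : M.ends e ∈ K.edgeSet ↔ e ∈ M.edgesOf K := ⟨fun h => ⟨he, h⟩, fun h => h.2⟩
    simp [h1]

lemma Rep.brl {M : MG W F} {H : SimpleGraph W} (h : Rep M H) (hb : ∀ e, ¬ H.IsBridge e) : M.Brl := by
  rintro A ⟨u, hu⟩ ⟨v, hv⟩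
  have hr : ∀ x y : W, (H.deleteEdges {s(x, y)}).Reachable x y := by
    intro x y
    have := hb s(x, y)
    rw [SimpleGraph.isBridge_iff, not_not] at this
    exact this
  have step : ∀ x y : W, x ∈ A → y ∉ A → ∃ e ∈ M.cut A, M.ends e ≠ s(x, y) ∧
      ∃ x' y', M.ends e = s(x', y') ∧ x' ∈ A ∧ y' ∉ A := by
    intro x y hx hy
    obtain ⟨p⟩ := hr x y
    obtain ⟨d, _, hd1, hd2⟩ := p.exists_boundary_dart A hx hy
    have had := d.adj
    rw [SimpleGraph.deleteEdges_adj] at had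
    obtain ⟨e, he, hee⟩ := (h.img _ _).1 had.1
    refine ⟨e, ⟨he, ?_⟩, ?_, _, _, hee, hd1, hd2⟩
    · rw [mem_cr_ends hee]; tauto
    · rw [hee]; simpa using had.2
  obtain ⟨e, he, _, x', y', hee, hx', hy'⟩ := step u v hu hv
  obtain ⟨f, hf, hne, _⟩ := step x' y' hx' hy'
  have : ({e, f} : Set F) ⊆ M.cut A := by
    rintro z (rfl | rfl) <;> assumption
  have h2 := Set.ncard_le_ncard this
  rwa [Set.ncard_pair] at h2
  rintro rfl; exact hne hee

lemma Rep.bridgeless {M : MG W F} {H : SimpleGraph W} (h : Rep M H) (hb : M.Brl) :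
    ∀ e, ¬ H.IsBridge e := by
  intro z
  induction z using Sym2.ind with
  | _ x y =>
  rw [SimpleGraph.isBridge_iff, not_not]
  by_contra hn
  have h2 := hb {v | (H.deleteEdges {s(x, y)}).Reachable x v} ⟨x, by simp⟩ ⟨y, hn⟩
  have h3 : (M.cut {v | (H.deleteEdges {s(x, y)}).Reachable x v}).ncard ≤ 1 := by
    rw [Set.ncard_le_one]
    have : ∀ e ∈ M.cut {v | (H.deleteEdges {s(x, y)}).Reachable x v}, M.ends e = s(x, y) := by
      rintro e ⟨he, hc⟩
      by_contra hne
      have hA : (H.deleteEdges {s(x, y)}).Adj (M.s e) (M.t e) := by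
        rw [SimpleGraph.deleteEdges_adj]
        exact ⟨(h.img _ _).2 ⟨e, he, rfl⟩, hne⟩
      rw [mem_cr] at hc
      exact hc ⟨fun h1 => SimpleGraph.Reachable.trans h1 hA.reachable,
          fun h1 => SimpleGraph.Reachable.trans h1 hA.reachable.symm⟩
    intro a ha b hb
    exact h.inj ha.1 hb.1 ((this a ha).trans (this b hb).symm)
  omega

end MG

namespace MG
variable {W F : Type} [Fintype W] [Fintype F]

noncomputable def prj (B : Set W) (x : W) : Option {x // x ∉ B} :=
  if h : x ∈ B then none else some ⟨x, h⟩

/-- contraction of the vertex set `B` to a single vertex -/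
noncomputable def contr (M : MG W F) (B : Set W) : MG (Option {x // x ∉ B}) F where
  s := fun e => prj B (M.s e)
  t := fun e => prj B (M.t e)
  E := {e ∈ M.E | ¬ (M.s e ∈ B ∧ M.t e ∈ B)}

lemma prj_none {B : Set W} {x : W} : prj B x = none ↔ x ∈ B := by
  unfold prj; split_ifs with h <;> simp [h]

lemma prj_some {B : Set W} {x : W} {v : {x // x ∉ B}} : prj B x = some v ↔ x = v.1 := by
  unfold prj; split_ifs with h
  · simp; rintro rfl; exact v.2 h
  · simp [Subtype.ext_iff]

lemma cr_contr (M : MG W F) (B : Set W) (X : Set (Option {x // x ∉ B})) :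
    (M.contr B).cr X = M.cr (prj B ⁻¹' X) := rfl

lemma cr_contr_none (M : MG W F) (B : Set W) : (M.contr B).cr {none} = M.cr B := by
  rw [cr_contr]; congr 1; ext x; simp [prj_none]

lemma cr_contr_some (M : MG W F) (B : Set W) (v : {x // x ∉ B}) :
    (M.contr B).cr {some v} = M.cr {v.1} := by
  rw [cr_contr]; congr 1; ext x; simp [prj_some]

lemma ev_contr (M : MG W F) (B : Set W) (T : Set F) :
    (M.contr B).Ev T ↔ (∀ v, v ∉ B → M.par T {v} = 0) ∧ M.par T B = 0 := by
  constructor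
  · intro h
    refine ⟨fun v hv => ?_, ?_⟩
    · have := h (some ⟨v, hv⟩)
      rw [cr_contr_some] at this
      rwa [par_eq_zero]
    · have := h none
      rw [cr_contr_none] at this
      rwa [par_eq_zero]
  · rintro ⟨h1, h2⟩ (_ | v)
    · rw [cr_contr_none, ← par_eq_zero]; exact h2
    · rw [cr_contr_some, ← par_eq_zero]; exact h1 v v.2

lemma cut_contr (M : MG W F) (B : Set W) (X : Set (Option {x // x ∉ B})) :
    (M.contr B).cut X = M.cut (prj B ⁻¹' X) := by
  ext e
  simp only [cut, cr_contr, Set.mem_inter_iff]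
  constructor
  · rintro ⟨h1, h2⟩; exact ⟨h1.1, h2⟩
  · rintro ⟨h1, h2⟩
    refine ⟨⟨h1, ?_⟩, h2⟩
    rintro ⟨h3, h4⟩
    rw [mem_cr] at h2
    simp only [Set.mem_preimage, prj_none.2 h3, prj_none.2 h4] at h2
    tauto

lemma Brl.contr {M : MG W F} (h : M.Brl) {B : Set W} (hB : B.Nonempty) : (M.contr B).Brl := by
  have hsurj : Function.Surjective (prj B) := by
    rintro (_ | v)
    · obtain ⟨b, hb⟩ := hB; exact ⟨b, prj_none.2 hb⟩
    · exact ⟨v.1, prj_some.2 rfl⟩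
  rintro X ⟨x, hx⟩ ⟨y, hy⟩
  rw [cut_contr]
  obtain ⟨x, rfl⟩ := hsurj x
  obtain ⟨y, rfl⟩ := hsurj y
  exact h _ ⟨x, hx⟩ ⟨y, hy⟩

lemma Lpl.contr {M : MG W F} (h : M.Lpl) (B : Set W) : (M.contr B).Lpl := by
  rintro e ⟨he, hB⟩ heq
  change prj B (M.s e) = prj B (M.t e) at heq
  cases h1 : prj B (M.t e) with
  | none =>
    rw [h1] at heq
    exact hB ⟨prj_none.1 heq, prj_none.1 h1⟩
  | some v =>
    rw [h1] at heq
    exact h e he ((prj_some.1 heq).trans (prj_some.1 h1).symm)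

lemma card_contr {B : Set W} [inst : Fintype (Option {x // x ∉ B})] (hB : 2 ≤ B.ncard) :
    Fintype.card (Option {x // x ∉ B}) < Fintype.card W := by
  have h0 : Fintype.card (Option {x // x ∉ B}) = Fintype.card {x // x ∉ B} + 1 := by
    rw [← Nat.card_eq_fintype_card, Finite.card_option, Nat.card_eq_fintype_card]
  rw [h0, Fintype.card_subtype_compl]
  have h1 : Fintype.card {x // x ∈ B} = B.ncard := by
    rw [Set.ncard_eq_toFinset_card', Set.toFinset_card]
  have h2 : Fintype.card {x // x ∈ B} ≤ Fintype.card W := Fintype.card_subtype_le _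
  omega

/-- the minimality hypothesis for simple graphs -/
def MinHyp (n m : ℕ) : Prop := ∀ (W : Type) [Fintype W] (H : SimpleGraph W),
      (∀ e, ¬ H.IsBridge e) →
      (Fintype.card W < n ∨
        (Fintype.card W = n ∧ H.edgeSet.ncard < m)) →
      ∀ C' : H.Subgraph, IsCycleSub C' →
        ∃ D : Multiset H.Subgraph, IsCDC H D ∧ C' ∈ D

lemma transfer_inj {n m : ℕ} (hmin : MinHyp n m) (M : MG W F) (hl : M.Lpl) (hb : M.Brl)
    (hinj : Set.InjOn M.ends M.E)
    (hs : Fintype.card W < n ∨ (Fintype.card W = n ∧ (M.ends '' M.E).ncard < m))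
    {C : Set F} (hC : M.Circ C) : M.Good C := by
  set H := SimpleGraph.fromEdgeSet (M.ends '' M.E) with hH
  have hrep : Rep M H := by
    refine ⟨hinj, fun x y => ?_⟩
    rw [hH, SimpleGraph.fromEdgeSet_adj]
    constructor
    · rintro ⟨⟨e, he, hee⟩, _⟩; exact ⟨e, he, hee⟩
    · rintro ⟨e, he, hee⟩
      refine ⟨⟨e, he, hee⟩, ?_⟩
      rintro rfl
      have := hl e he
      apply this
      rcases Sym2.eq_iff.1 hee with ⟨h1, h2⟩ | ⟨h1, h2⟩ <;> rw [h1, h2]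
  have hE : H.edgeSet.ncard ≤ (M.ends '' M.E).ncard := by
    rw [hH, SimpleGraph.edgeSet_fromEdgeSet]
    exact Set.ncard_le_ncard Set.sdiff_subset
  have hmin' := hmin W H (hrep.bridgeless hb) (by omega)
  have hmap : ∀ D : Multiset H.Subgraph, (∀ K ∈ D, IsCycleSub K) →
      ∀ T ∈ D.map M.edgesOf, T ⊆ M.E ∧ M.Ev T := by
    intro D hD T hT
    obtain ⟨K, hK, rfl⟩ := Multiset.mem_map.1 hT
    exact ⟨fun e he => he.1, hrep.ev (hD K hK).2⟩
  have hedge : ∀ e ∈ M.E, M.ends e ∈ H.edgeSet := fun e he => (hrep.img _ _).2 ⟨e, he, rfl⟩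
  by_cases hne : C = ∅
  · subst hne
    by_cases hE0 : M.E = ∅
    · exact ⟨0, by simp, by simp [hE0]⟩
    · obtain ⟨e0, he0⟩ := Set.nonempty_iff_ne_empty.2 hE0
      have h1 : ∃ K : H.Subgraph, IsCycleSub K := by
        have := hrep.bridgeless hb (M.ends e0)
        rw [SimpleGraph.isBridge_iff_forall_cycle_notMem (hedge e0 he0)] at this
        push Not at this
        obtain ⟨u, p, hp, _⟩ := this
        exact ⟨_, isCycleSub_of_isCycle hp⟩
      obtain ⟨K, hK⟩ := h1
      obtain ⟨D, hD, _⟩ := hmin' K hK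
      refine ⟨D.map M.edgesOf, hmap D hD.1, ?_⟩
      intro e he
      rw [hrep.cov_map D he]
      have := hD.2 _ (hedge e he)
      simp only [Set.mem_empty_iff_false, if_false, add_zero]
      convert this
  · obtain ⟨e0, he0⟩ := Set.nonempty_iff_ne_empty.2 hne
    obtain ⟨P, hP, hPC, he0P⟩ := hrep.cyc_in hC.1 hC.2.1 he0
    have hPeq : M.edgesOf P = C := by
      rcases hC.2.2 _ hPC (hrep.ev hP.2) with h | h
      · rw [h] at he0P; exact he0P.elim
      · exact h
    obtain ⟨D, hD, hPD⟩ := hmin' P hP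
    obtain ⟨D', rfl⟩ := Multiset.exists_cons_of_mem hPD
    refine ⟨D'.map M.edgesOf, hmap D' fun K hK => hD.1 K (Multiset.mem_cons_of_mem hK), ?_⟩
    intro e he
    have := hD.2 _ (hedge e he)
    have h2 := hrep.cov_map (P ::ₘ D') he
    rw [Multiset.map_cons, cov_cons, hPeq] at h2
    rw [h2]
    convert this

def del (M : MG W F) (S : Set F) : MG W F := ⟨M.s, M.t, M.E \ S⟩

lemma ev_del {M : MG W F} {S T : Set F} : (M.del S).Ev T ↔ M.Ev T := Iff.rfl

lemma Lpl.del {M : MG W F} (h : M.Lpl) (S : Set F) : (M.del S).Lpl := fun e he => h e he.1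

lemma cut_del (M : MG W F) (S : Set F) (A : Set W) : (M.del S).cut A = M.cut A \ S := by
  ext e
  have : (M.del S).cr A = M.cr A := rfl
  simp only [cut, this, Set.mem_inter_iff, Set.mem_sdiff]
  have : e ∈ (M.del S).E ↔ e ∈ M.E ∧ e ∉ S := Iff.rfl
  tauto

lemma circ_del {M : MG W F} {S C : Set F} (hC : M.Circ C) (h : ∀ e ∈ C, e ∉ S) : (M.del S).Circ C :=
  ⟨fun e he => ⟨hC.1 he, h e he⟩, hC.2.1, hC.2.2⟩

lemma circ_empty (M : MG W F) : M.Circ ∅ :=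
  ⟨by simp, ev_empty M, fun T hT _ => Or.inl (Set.subset_empty_iff.1 hT)⟩

lemma transfer {n m : ℕ} (hmin : MinHyp n m) (k : ℕ) : ∀ (W : Type) [Fintype W] (M : MG W F),
    M.E.ncard ≤ k → M.Lpl → M.Brl →
    (Fintype.card W < n ∨ (Fintype.card W = n ∧ (M.ends '' M.E).ncard < m)) →
    ∀ C, M.Circ C → M.Good C := by
  induction k with
  | zero =>
    intro W _ M hk hl hb hs C hC
    have h0 : M.E = ∅ := by rw [← Set.ncard_eq_zero]; omega
    exact transfer_inj hmin M hl hb (by simp [h0]) hs hC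
  | succ k ih =>
    intro W _ M hk hl hb hs C hC
    by_cases hinj : Set.InjOn M.ends M.E
    · exact transfer_inj hmin M hl hb hinj hs hC
    rw [Set.InjOn] at hinj
    push Not at hinj
    obtain ⟨e, he, e', he', hee, hne⟩ := hinj
    have hcr : ∀ A, e ∈ M.cr A ↔ e' ∈ M.cr A := by
      intro A
      rw [mem_cr_ends (M := M) (e := e) rfl, mem_cr_ends (M := M) (e := e') hee.symm]
    have hQ : M.Ev {e, e'} := by
      intro v
      by_cases h : e ∈ M.cr {v}
      · have : ({e, e'} : Set F) ∩ M.cr {v} = {e, e'} := by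
          apply Set.inter_eq_left.2
          rintro x (rfl | rfl)
          · exact h
          · exact (hcr _).1 h
        rw [this, Set.ncard_pair hne]; exact even_two
      · have : ({e, e'} : Set F) ∩ M.cr {v} = ∅ := by
          ext x; simp only [Set.mem_inter_iff, Set.mem_empty_iff_false, iff_false, not_and]
          rintro (rfl | rfl)
          · exact h
          · exact fun h2 => h ((hcr _).2 h2)
        simp [this]
    have hQE : ({e, e'} : Set F) ⊆ M.E := by rintro x (rfl | rfl) <;> assumption
    have hlt : ∀ S : Set F, S ⊆ M.E → e' ∉ S → S.ncard ≤ k := by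
      intro S hS heS
      have : S.ncard < M.E.ncard := Set.ncard_lt_ncard ⟨hS, fun h => heS (h he')⟩ (Set.toFinite _)
      omega
    by_cases hb1 : (M.del {e'}).Brl
    · have hs1 : (Fintype.card W < n ∨ (Fintype.card W = n ∧ ((M.del {e'}).ends '' (M.del {e'}).E).ncard < m)) := by
        have : ((M.del {e'}).ends '' (M.del {e'}).E).ncard ≤ (M.ends '' M.E).ncard :=
          Set.ncard_le_ncard (Set.image_mono Set.sdiff_subset)
        omega
      have ih1 := ih W (M.del {e'}) (hlt _ Set.sdiff_subset (by simp [del])) (hl.del _) hb1 hs1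
      have hmemE : ∀ f, f ∈ (M.del {e'}).E ↔ f ∈ M.E ∧ f ≠ e' := fun f => Iff.rfl
      by_cases hc' : e' ∈ C
      · by_cases hc : e ∈ C
        · -- C = {e,e'}
          have hCQ : ({e, e'} : Set F) = C := by
            rcases hC.2.2 {e, e'} (by rintro x (rfl | rfl) <;> assumption) hQ with h | h
            · have : e ∈ (∅ : Set F) := by rw [← h]; simp
              exact this.elim
            · exact h
          subst hCQ
          obtain ⟨D, hD, hcov⟩ := ih1 ∅ (circ_empty _)
          have h1 := hcov e ⟨he, hne⟩
          obtain ⟨Y, D', rfl, hY⟩ := cov_pos (D := D) (e := e) (by simp at h1; omega)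
          have hYE := hD Y (Multiset.mem_cons_self _ _)
          have he'Y : e' ∉ Y := fun h => (hYE.1 h).2 rfl
          have hD0 : cov D' e' = 0 := cov_zero_iff.2 fun X hX h =>
            ((hD X (Multiset.mem_cons_of_mem hX)).1 h).2 rfl
          refine ⟨(Y ∆ {e, e'}) ::ₘ D', ?_, ?_⟩
          · intro T hT
            rcases Multiset.mem_cons.1 hT with rfl | hT
            · exact ⟨fun f hf => hf.elim (fun h => (hYE.1 h.1).1) (fun h => hQE h.1), Ev.symmDiff (M := M) hYE.2 hQ⟩
            · exact ⟨fun f hf => ((hD T (Multiset.mem_cons_of_mem hT)).1 hf).1, (hD T (Multiset.mem_cons_of_mem hT)).2⟩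
          · intro f hf
            by_cases hf1 : f = e'
            · subst hf1
              simp [hD0, Set.mem_symmDiff, he'Y]
            · have h2 := hcov f ⟨hf, hf1⟩
              by_cases hf2 : f = e
              · subst hf2
                simp [Set.mem_symmDiff, hY] at h2 ⊢; omega
              · simp [Set.mem_symmDiff, hf1, hf2] at h2 ⊢; omega
        · have hC1 : (M.del {e'}).Circ (C ∆ {e, e'}) := by
            refine ⟨?_, hC.2.1.symmDiff hQ, ?_⟩
            · intro f hf
              rw [hmemE]
              rcases hf with ⟨h1, h2⟩ | ⟨h1, h2⟩
              · exact ⟨hC.1 h1, fun h => h2 (by simp [h])⟩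
              · refine ⟨hQE h1, ?_⟩
                rintro rfl; exact h2 hc'
            · intro T hT hTev
              by_cases heT : e ∈ T
              · right
                have h1 : T ∆ {e, e'} ⊆ C := by
                  intro f hf
                  rcases hf with ⟨h1, h2⟩ | ⟨h1, h2⟩
                  · rcases hT h1 with h3 | h3
                    · exact h3.1
                    · exact (h2 h3.1).elim
                  · rcases h1 with rfl | rfl
                    · exact (h2 heT).elim
                    · exact hc'
                have he'T : e' ∉ T := fun h => by
                  have := hT h
                  simp [Set.mem_symmDiff, hc'] at this
                rcases hC.2.2 _ h1 (Ev.symmDiff (M := M) hTev hQ) with h | h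
                · have : e' ∈ (∅ : Set F) := by rw [← h]; simp [Set.mem_symmDiff, he'T]
                  exact this.elim
                · rw [← h, symmDiff_assoc, symmDiff_self]; exact (symmDiff_bot T).symm
              · left
                have h1 : T ⊆ C := by
                  intro f hf
                  rcases hT hf with h3 | h3
                  · exact h3.1
                  · rcases h3.1 with rfl | rfl
                    · exact (heT hf).elim
                    · exact hc'
                rcases hC.2.2 _ h1 hTev with h | h
                · exact h
                · subst h
                  have := hT hc'
                  simp [Set.mem_symmDiff, hc'] at this
          obtain ⟨D, hD, hcov⟩ := ih1 _ hC1
          have hD0 : cov D e' = 0 := cov_zero_iff.2 fun X hX h =>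
            ((hD X hX).1 h).2 rfl
          refine ⟨{e, e'} ::ₘ D, ?_, ?_⟩
          · intro T hT
            rcases Multiset.mem_cons.1 hT with rfl | hT
            · exact ⟨hQE, hQ⟩
            · exact ⟨fun f hf => ((hD T hT).1 hf).1, (hD T hT).2⟩
          · intro f hf
            by_cases hf1 : f = e'
            · subst hf1
              simp [hD0, hc']
            · have h2 := hcov f ⟨hf, hf1⟩
              by_cases hf2 : f = e
              · subst hf2
                simp [Set.mem_symmDiff, hc] at h2 ⊢; omega
              · simp [Set.mem_symmDiff, hf1, hf2] at h2 ⊢; omega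
      · obtain ⟨D, hD, hcov⟩ := ih1 C (circ_del hC (by rintro f hf rfl; exact hc' hf))
        have h1 := hcov e ⟨he, hne⟩
        obtain ⟨Y, D', rfl, hY⟩ := cov_pos (D := D) (e := e) (by split_ifs at h1 <;> omega)
        have hYE := hD Y (Multiset.mem_cons_self _ _)
        have he'Y : e' ∉ Y := fun h => (hYE.1 h).2 rfl
        have hD0 : cov D' e' = 0 := cov_zero_iff.2 fun X hX h =>
          ((hD X (Multiset.mem_cons_of_mem hX)).1 h).2 rfl
        refine ⟨(Y ∆ {e, e'}) ::ₘ {e, e'} ::ₘ D', ?_, ?_⟩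
        · intro T hT
          rcases Multiset.mem_cons.1 hT with rfl | hT
          · exact ⟨fun f hf => hf.elim (fun h => (hYE.1 h.1).1) (fun h => hQE h.1), Ev.symmDiff (M := M) hYE.2 hQ⟩
          rcases Multiset.mem_cons.1 hT with rfl | hT
          · exact ⟨hQE, hQ⟩
          · exact ⟨fun f hf => ((hD T (Multiset.mem_cons_of_mem hT)).1 hf).1, (hD T (Multiset.mem_cons_of_mem hT)).2⟩
        · intro f hf
          by_cases hf1 : f = e'
          · subst hf1
            simp [hD0, Set.mem_symmDiff, he'Y, hc']
          · have h2 := hcov f ⟨hf, hf1⟩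
            by_cases hf2 : f = e
            · subst hf2
              simp [Set.mem_symmDiff, hY] at h2 ⊢; omega
            · simp [Set.mem_symmDiff, hf1, hf2] at h2 ⊢; omega
    · -- {e,e'} is a 2-cut
      rw [Brl] at hb1
      push Not at hb1
      obtain ⟨A, hA1, hA2, hA3⟩ := hb1
      have hA4 := hb A hA1 hA2
      rw [cut_del] at hA3
      have he'A : e' ∈ M.cut A := by
        by_contra h
        rw [Set.sdiff_singleton_eq_self h] at hA3
        omega
      have heA : e ∈ M.cut A := ⟨he, (hcr A).2 he'A.2⟩
      have hcutA : ∀ f ∈ M.cut A, f = e ∨ f = e' := by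
        intro f hf
        by_contra hcon
        push Not at hcon
        have : ({e, f} : Set F) ⊆ M.cut A \ {e'} := by
          rintro x (rfl | rfl)
          · exact ⟨heA, hne⟩
          · exact ⟨hf, hcon.2⟩
        have h2 := Set.ncard_le_ncard this
        rw [Set.ncard_pair hcon.1.symm] at h2
        omega
      set B : Set W := {M.s e, M.t e} with hB
      have hBcard : 2 ≤ B.ncard := by rw [hB, Set.ncard_pair (hl e he)]
      have hE2 : ∀ f, f ∈ (M.contr B).E ↔ f ∈ M.E ∧ f ≠ e ∧ f ≠ e' := by
        intro f
        constructor
        · rintro ⟨h1, h2⟩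
          refine ⟨h1, ?_, ?_⟩
          · rintro rfl; exact h2 ⟨by simp [hB], by simp [hB]⟩
          · rintro rfl
            rcases Sym2.eq_iff.1 hee with ⟨h3, h4⟩ | ⟨h3, h4⟩ <;> exact h2 ⟨by simp [hB, h3, h4], by simp [hB, h3, h4]⟩
        · rintro ⟨h1, h2, h3⟩
          refine ⟨h1, ?_⟩
          rintro ⟨h4, h5⟩
          have h6 : M.ends f = s(M.s e, M.t e) := by
            have h7 := hl f h1
            rw [hB] at h4 h5
            simp only [Set.mem_insert_iff, Set.mem_singleton_iff] at h4 h5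
            rcases h4 with h4 | h4 <;> rcases h5 with h5 | h5
            · exact (h7 (h4.trans h5.symm)).elim
            · rw [ends, h4, h5]
            · rw [ends, h4, h5, Sym2.eq_swap]
            · exact (h7 (h4.trans h5.symm)).elim
          have h8 : f ∈ M.cut A := ⟨h1, by
            rw [mem_cr_ends h6]
            exact heA.2⟩
          rcases hcutA f h8 with h | h
          · exact h2 h
          · exact h3 h
      have hev : ∀ T, T ⊆ (M.contr B).E → ((M.contr B).Ev T ↔ M.Ev T) := by
        intro T hT
        rw [ev_contr, ev_iff]
        constructor
        · rintro ⟨h1, h2⟩ u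
          by_cases hu : u ∈ B
          · have h0 : ∀ A' : Set W, M.cr A' = M.cr A → u ∈ A' → (∀ v ∈ A', v ≠ u → v ∉ B) → M.par T {u} = 0 := by
              intro A' hA' hu' hv
              have h3 : M.par T A' = 0 := by
                have : T ∩ M.cr A' = ∅ := by
                  ext f; simp only [Set.mem_inter_iff, Set.mem_empty_iff_false, iff_false, not_and]
                  intro hf hfc
                  rw [hA'] at hfc
                  have h5 := (hE2 f).1 (hT hf)
                  rcases hcutA f ⟨h5.1, hfc⟩ with h | h
                  · exact h5.2.1 h
                  · exact h5.2.2 h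
                simp [par, this]
              rw [par_sum, Finset.sum_eq_single u] at h3
              · simpa [hu'] using h3
              · intro v _ hvu
                split_ifs with h
                · exact h1 v (hv v h hvu)
                · rfl
              · simp
            have hx := mem_cr.1 heA.2
            rw [hB] at hu
            by_cases huA : u ∈ A
            · refine h0 A rfl huA ?_
              intro v hv hvu hvB
              rw [hB] at hvB
              rcases hu with rfl | rfl <;> rcases hvB with rfl | rfl <;> tauto
            · refine h0 Aᶜ (cr_compl _ _) huA ?_
              intro v hv hvu hvB
              rw [Set.mem_compl_iff] at hv
              rw [hB] at hvB
              rcases hu with rfl | rfl <;> rcases hvB with rfl | rfl <;> tauto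
          · exact h1 u hu
        · intro h
          exact ⟨fun v _ => h v, M.par_of_even fun v _ => h v⟩
      have ih2 := ih _ (M.contr B) (hlt _ (fun f hf => ((hE2 f).1 hf).1)
        (fun h => ((hE2 e').1 h).2.2 rfl)) (hl.contr B) (hb.contr ⟨M.s e, by simp [hB]⟩)
        (by have := card_contr hBcard; left; omega)
      have hfin : ∀ C', (M.contr B).Circ C' → ∃ D : Multiset (Set F), (∀ T ∈ D, T ⊆ M.E ∧ M.Ev T) ∧
          (∀ f ∈ M.E, f ≠ e → f ≠ e' → cov D f + (if f ∈ C' then 1 else 0) = 2) ∧ cov D e = 0 ∧ cov D e' = 0 := by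
        intro C' hC'
        obtain ⟨D, hD, hcov⟩ := ih2 C' hC'
        refine ⟨D, ?_, ?_, ?_, ?_⟩
        · intro T hT
          exact ⟨fun f hf => ((hE2 f).1 ((hD T hT).1 hf)).1, (hev T (hD T hT).1).1 (hD T hT).2⟩
        · intro f hf h1 h2
          exact hcov f ((hE2 f).2 ⟨hf, h1, h2⟩)
        · exact cov_zero_iff.2 fun X hX h => ((hE2 e).1 ((hD X hX).1 h)).2.1 rfl
        · exact cov_zero_iff.2 fun X hX h => ((hE2 e').1 ((hD X hX).1 h)).2.2 rfl
      have hCe : e ∈ C ↔ e' ∈ C := by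
        by_contra hcon
        have h1 := hC.2.1.cut A
        have h2 : (C ∩ M.cr A).ncard = 1 := by
          rw [Set.ncard_eq_one]
          by_cases h : e ∈ C
          · refine ⟨e, ?_⟩
            ext f; simp only [Set.mem_inter_iff, Set.mem_singleton_iff]
            constructor
            · rintro ⟨h3, h4⟩
              rcases hcutA f ⟨hC.1 h3, h4⟩ with rfl | rfl
              · rfl
              · tauto
            · rintro rfl; exact ⟨h, heA.2⟩
          · refine ⟨e', ?_⟩
            ext f; simp only [Set.mem_inter_iff, Set.mem_singleton_iff]
            constructor
            · rintro ⟨h3, h4⟩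
              rcases hcutA f ⟨hC.1 h3, h4⟩ with rfl | rfl
              · tauto
              · rfl
            · rintro rfl; exact ⟨by tauto, he'A.2⟩
        rw [h2] at h1
        simp at h1
      by_cases hc : e ∈ C
      · have hc' := hCe.1 hc
        have hCQ : ({e, e'} : Set F) = C := by
          rcases hC.2.2 {e, e'} (by rintro x (rfl | rfl) <;> assumption) hQ with h | h
          · have : e ∈ (∅ : Set F) := by rw [← h]; simp
            exact this.elim
          · exact h
        subst hCQ
        obtain ⟨D, hD, hcov, h1, h2⟩ := hfin ∅ (circ_empty _)
        refine ⟨{e, e'} ::ₘ D, ?_, ?_⟩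
        · intro T hT
          rcases Multiset.mem_cons.1 hT with rfl | hT
          · exact ⟨hQE, hQ⟩
          · exact hD T hT
        · intro f hf
          by_cases hf1 : f = e
          · subst hf1; simp [h1]
          · by_cases hf2 : f = e'
            · subst hf2; simp [h2]
            · have := hcov f hf hf1 hf2
              simp [hf1, hf2] at this ⊢; omega
      · have hc' : e' ∉ C := fun h => hc (hCe.2 h)
        have hCE : C ⊆ (M.contr B).E := by
          intro f hf
          rw [hE2]
          refine ⟨hC.1 hf, ?_, ?_⟩
          · rintro rfl; exact hc hf
          · rintro rfl; exact hc' hf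
        obtain ⟨D, hD, hcov, h1, h2⟩ := hfin C ⟨hCE, (hev C hCE).2 hC.2.1, fun T hT hTe =>
          hC.2.2 T hT ((hev T (hT.trans hCE)).1 hTe)⟩
        refine ⟨{e, e'} ::ₘ {e, e'} ::ₘ D, ?_, ?_⟩
        · intro T hT
          simp only [Multiset.mem_cons] at hT
          rcases hT with rfl | rfl | hT
          · exact ⟨hQE, hQ⟩
          · exact ⟨hQE, hQ⟩
          · exact hD T hT
        · intro f hf
          by_cases hf1 : f = e
          · subst hf1; simp [h1, hc]
          · by_cases hf2 : f = e'
            · subst hf2; simp [h2, hc']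
            · have := hcov f hf hf1 hf2
              simp [hf1, hf2] at this ⊢; omega

end MG

namespace MG
variable {W F : Type} [Fintype W] [Fintype F]

lemma cov_three {D : Multiset (Set F)} {a b c : F}
    (h : ∀ T ∈ D, ((a ∈ T ∧ b ∈ T ∧ c ∉ T) ∨ (a ∈ T ∧ b ∉ T ∧ c ∈ T) ∨
      (a ∉ T ∧ b ∈ T ∧ c ∈ T) ∨ (a ∉ T ∧ b ∉ T ∧ c ∉ T))) :
    cov D c ≤ cov D a + cov D b ∧
      ((∃ T ∈ D, a ∈ T ∧ b ∈ T) ↔ cov D c < cov D a + cov D b) := by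
  induction D using Multiset.induction_on with
  | empty => simp
  | cons T D ih =>
    obtain ⟨ih1, ih2⟩ := ih fun T' hT' => h T' (Multiset.mem_cons_of_mem hT')
    have hT := h T (Multiset.mem_cons_self _ _)
    simp only [Multiset.mem_cons, exists_eq_or_imp, cov_cons]
    rw [ih2]
    rcases hT with ⟨h1, h2, h3⟩ | ⟨h1, h2, h3⟩ | ⟨h1, h2, h3⟩ | ⟨h1, h2, h3⟩ <;>
      simp [h1, h2, h3] <;> omega

lemma trace_match {K : Set F} (hK : K.ncard ≤ 3) {D1 D2 : Multiset (Set F)}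
    (h1 : ∀ T ∈ D1, Even (T ∩ K).ncard) (h2 : ∀ T ∈ D2, Even (T ∩ K).ncard)
    (hcov : ∀ e ∈ K, cov D1 e = cov D2 e) {T : Set F} (hT : T ∈ D1) (hne : (T ∩ K).Nonempty) :
    ∃ T2 ∈ D2, T2 ∩ K = T ∩ K := by
  have two : ∀ S : Set F, (S ∩ K).Nonempty → Even (S ∩ K).ncard → 2 ≤ (S ∩ K).ncard := by
    intro S hS he
    have := (Set.ncard_pos (Set.toFinite _)).2 hS
    obtain ⟨k, hk⟩ := he
    omega
  have hT2 := two T hne (h1 T hT)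
  by_cases hK2 : K.ncard ≤ 2
  · obtain ⟨e, heT, heK⟩ := hne
    have hp : 0 < cov D2 e := by
      rw [← hcov e heK]
      obtain ⟨D', rfl⟩ := Multiset.exists_cons_of_mem hT
      simp [heT]
    obtain ⟨X, D', rfl, hX⟩ := cov_pos hp
    refine ⟨X, Multiset.mem_cons_self _ _, ?_⟩
    have hX2 := two X ⟨e, hX, heK⟩ (h2 X (Multiset.mem_cons_self _ _))
    rw [Set.eq_of_subset_of_ncard_le (Set.inter_subset_right : X ∩ K ⊆ K) (by omega),
      Set.eq_of_subset_of_ncard_le (Set.inter_subset_right : T ∩ K ⊆ K) (by omega)]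
  · obtain ⟨x, y, z, hxy, hxz, hyz, rfl⟩ := Set.ncard_eq_three.1 (show K.ncard = 3 by omega)
    have key : ∀ a b c : F, a ≠ b → a ≠ c → b ≠ c → ({x, y, z} : Set F) = {a, b, c} →
        a ∈ T → b ∈ T → c ∉ T → ∃ T2 ∈ D2, T2 ∩ {x, y, z} = T ∩ {x, y, z} := by
      intro a b c hab hac hbc hK ha hb hc
      rw [hK] at h1 h2 hcov ⊢
      have e3 : ∀ S : Set F, Even (S ∩ {a, b, c}).ncard → _ := fun S =>
        (even_triple (T := S) (E := Set.univ) (K := {a, b, c}) (Set.subset_univ _) (by simp) hab hac hbc).1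
      have c1 := cov_three (D := D1) (a := a) (b := b) (c := c) fun S hS => e3 S (h1 S hS)
      have c2 := cov_three (D := D2) (a := a) (b := b) (c := c) fun S hS => e3 S (h2 S hS)
      have := c1.2.1 ⟨T, hT, ha, hb⟩
      rw [hcov a (by simp), hcov b (by simp), hcov c (by simp)] at this
      obtain ⟨X, hX, hXa, hXb⟩ := c2.2.2 this
      refine ⟨X, hX, ?_⟩
      have := e3 X (h2 X hX)
      ext f
      simp only [Set.mem_inter_iff, Set.mem_insert_iff, Set.mem_singleton_iff]
      constructor
      · rintro ⟨h3, rfl | rfl | rfl⟩ <;> tauto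
      · rintro ⟨h3, rfl | rfl | rfl⟩ <;> tauto
    have := (even_triple (T := T) (E := Set.univ) (K := {x, y, z}) (Set.subset_univ _) (by simp)
      hxy hxz hyz).1 (h1 T hT)
    rcases this with ⟨ha, hb, hc⟩ | ⟨ha, hb, hc⟩ | ⟨ha, hb, hc⟩ | ⟨ha, hb, hc⟩
    · exact key x y z hxy hxz hyz rfl ha hb hc
    · exact key x z y hxz hxy hyz.symm (by rw [Set.pair_comm]) ha hc hb
    · exact key y z x hyz hxy.symm hxz.symm (by ext f; simp; tauto) hb hc ha
    · obtain ⟨f, hf, hf'⟩ := hne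
      rcases hf' with rfl | rfl | rfl <;> tauto

lemma mem_contr_E {M : MG W F} {B : Set W} {e : F} :
    e ∈ (M.contr B).E ↔ e ∈ M.E ∧ ¬ (M.s e ∈ B ∧ M.t e ∈ B) := Iff.rfl

lemma ev_contr_inter {M : MG W F} {B : Set W} {T : Set F} (hTE : T ⊆ M.E) (hT : M.Ev T) :
    (M.contr B).Ev (T ∩ (M.contr B).E) := by
  have h0 : ∀ X : Set W, (∀ e, M.s e ∈ B → M.t e ∈ B → e ∉ M.cr X) → M.par (T ∩ (M.contr B).E) X = M.par T X := by
    intro X hX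
    have : T ∩ (M.contr B).E ∩ M.cr X = T ∩ M.cr X := by
      ext e
      simp only [Set.mem_inter_iff, mem_contr_E]
      have := hX e
      have := @hTE e
      tauto
    simp [par, this]
  rw [ev_contr]
  constructor
  · intro v hv
    rw [h0]
    · exact (M.ev_iff T).1 hT v
    · intro e h1 h2
      rw [mem_cr]
      simp only [Set.mem_singleton_iff]
      have h3 : M.s e ≠ v := by rintro rfl; exact hv h1
      have h4 : M.t e ≠ v := by rintro rfl; exact hv h2
      tauto
  · rw [h0, par_eq_zero]
    · exact hT.cut B
    · intro e h1 h2; rw [mem_cr]; tauto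

/-- gluing two even sets with a common trace -/
lemma ev_glue {M : MG W F} {B : Set W} {T1 T2 : Set F} (h1 : T1 ⊆ (M.contr B).E)
    (h2 : T2 ⊆ (M.contr Bᶜ).E) (hT1 : (M.contr B).Ev T1) (hT2 : (M.contr Bᶜ).Ev T2)
    (htr : T1 ∩ M.cut B = T2 ∩ M.cut B) : M.Ev (T1 ∪ T2) := by
  rw [ev_contr] at hT1 hT2
  have htr' : ∀ e, e ∈ M.E → e ∈ M.cr B → (e ∈ T1 ↔ e ∈ T2) := by
    intro e he hc
    have := Set.ext_iff.1 htr e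
    simp only [Set.mem_inter_iff, cut] at this
    tauto
  rw [ev_iff]
  intro v
  by_cases hv : v ∈ B
  · rw [← hT2.1 v (by simpa using hv)]
    have : (T1 ∪ T2) ∩ M.cr {v} = T2 ∩ M.cr {v} := by
      ext e
      simp only [Set.mem_inter_iff, Set.mem_union]
      constructor
      · rintro ⟨h | h, h3⟩
        · have h4 := mem_contr_E.1 (h1 h)
          refine ⟨(htr' e h4.1 ?_).1 h, h3⟩
          rw [mem_cr] at h3 ⊢
          simp only [Set.mem_singleton_iff] at h3
          intro h5
          have : M.s e ∈ B ∨ M.t e ∈ B := by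
            by_contra hcon; push Not at hcon
            apply h3
            constructor
            · intro h; rw [h] at hcon; tauto
            · intro h; rw [h] at hcon; tauto
          tauto
        · exact ⟨h, h3⟩
      · rintro ⟨h, h3⟩; exact ⟨Or.inr h, h3⟩
    simp [par, this]
  · rw [← hT1.1 v hv]
    have : (T1 ∪ T2) ∩ M.cr {v} = T1 ∩ M.cr {v} := by
      ext e
      simp only [Set.mem_inter_iff, Set.mem_union]
      constructor
      · rintro ⟨h | h, h3⟩
        · exact ⟨h, h3⟩
        · have h4 := mem_contr_E.1 (h2 h)
          refine ⟨(htr' e h4.1 ?_).2 h, h3⟩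
          simp only [Set.mem_compl_iff] at h4
          rw [mem_cr] at h3 ⊢
          simp only [Set.mem_singleton_iff] at h3
          intro h5
          have : M.s e ∉ B ∨ M.t e ∉ B := by
            by_contra hcon; push Not at hcon
            apply h3
            constructor
            · intro h; rw [h] at hcon; tauto
            · intro h; rw [h] at hcon; tauto
          tauto
      · rintro ⟨h, h3⟩; exact ⟨Or.inl h, h3⟩
    simp [par, this]

lemma circ_contr {M : MG W F} {C : Set F} (hC : M.Circ C) {B : Set W} (hB : (M.cut B).ncard ≤ 3) :
    (M.contr B).Circ (C ∩ (M.contr B).E) := by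
  refine ⟨Set.inter_subset_right, ev_contr_inter hC.1 hC.2.1, ?_⟩
  have key : ∀ T, T ⊆ C ∩ (M.contr B).E → (M.contr B).Ev T → T ∩ M.cr B = ∅ → M.Ev T := by
    intro T hT hTe hTc
    have := ev_glue (M := M) (B := B) (T1 := T) (T2 := ∅) (fun e he => (hT he).2) (by simp) hTe
      (ev_empty _) (by
        ext e
        have := Set.ext_iff.1 hTc e
        simp only [Set.mem_inter_iff, cut, Set.mem_empty_iff_false] at *
        tauto)
    simpa using this
  have hC2 : (C ∩ M.cr B).ncard ≤ 2 := by
    have h1 : C ∩ M.cr B ⊆ M.cut B := fun e he => ⟨hC.1 he.1, he.2⟩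
    have h2 := Set.ncard_le_ncard h1
    obtain ⟨k, hk⟩ := hC.2.1.cut B
    omega
  intro T hT hTe
  by_cases hTc : T ∩ M.cr B = ∅
  · rcases hC.2.2 T (fun e he => (hT he).1) (key T hT hTe hTc) with h | h
    · exact Or.inl h
    · right
      apply Set.Subset.antisymm hT
      rw [h]; exact Set.inter_subset_left
  · right
    have hT2 : 2 ≤ (T ∩ M.cr B).ncard := by
      have h1 := (Set.ncard_pos (Set.toFinite _)).2 (Set.nonempty_iff_ne_empty.2 hTc)
      obtain ⟨k, hk⟩ := (M.par_eq_zero T B).1 ((ev_contr M B T).1 hTe).2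
      omega
    have heq : T ∩ M.cr B = C ∩ M.cr B := by
      apply Set.eq_of_subset_of_ncard_le _ (by omega)
      exact fun e he => ⟨(hT he.1).1, he.2⟩
    have h1 : (M.contr B).Ev ((C ∩ (M.contr B).E) \ T) :=
      (ev_contr_inter hC.1 hC.2.1).sdiff hTe hT
    have h2 := key _ (Set.sdiff_subset) h1 (by
      ext e
      have := Set.ext_iff.1 heq e
      simp only [Set.mem_inter_iff, Set.mem_sdiff, Set.mem_empty_iff_false] at *
      tauto)
    rcases hC.2.2 _ (fun e he => he.1.1) h2 with h | h
    · exact Set.Subset.antisymm hT (Set.sdiff_eq_empty.1 h)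
    · exfalso
      obtain ⟨e, he⟩ := Set.nonempty_iff_ne_empty.2 hTc
      have : e ∈ C := (hT he.1).1
      rw [← h] at this
      exact this.2 he.1

lemma glue_covers {M : MG W F} {B : Set W} (hB : (M.cut B).ncard ≤ 3) (D1 : Multiset (Set F)) :
    ∀ D2 : Multiset (Set F),
    (∀ T ∈ D1, T ⊆ (M.contr B).E ∧ (M.contr B).Ev T) →
    (∀ T ∈ D2, T ⊆ (M.contr Bᶜ).E ∧ (M.contr Bᶜ).Ev T) →
    (∀ e ∈ M.cut B, cov D1 e = cov D2 e) →
    ∃ D : Multiset (Set F), (∀ T ∈ D, T ⊆ M.E ∧ M.Ev T) ∧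
      (∀ e ∈ (M.contr B).E, cov D e = cov D1 e) ∧ (∀ e ∈ (M.contr Bᶜ).E, cov D e = cov D2 e) := by
  have hcut : ∀ e, e ∈ (M.contr B).E → e ∈ (M.contr Bᶜ).E → e ∈ M.cut B := by
    intro e h1 h2
    rw [mem_contr_E] at h1 h2
    refine ⟨h1.1, ?_⟩
    rw [mem_cr]; simp only [Set.mem_compl_iff] at h2; tauto
  have hcut1 : ∀ e, e ∈ M.cut B → e ∈ (M.contr B).E ∧ e ∈ (M.contr Bᶜ).E := by
    rintro e ⟨h1, h2⟩
    rw [mem_cr] at h2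
    simp only [mem_contr_E, Set.mem_compl_iff]; tauto
  have hE1 : (M.contr B).E ⊆ M.E := fun e he => he.1
  have hE2 : (M.contr Bᶜ).E ⊆ M.E := fun e he => he.1
  have hevcut : ∀ T, T ⊆ M.E → M.par T B = 0 → Even (T ∩ M.cut B).ncard := by
    intro T hT h
    rw [par_eq_zero] at h
    convert h using 2
    ext e; have := @hT e; simp only [Set.mem_inter_iff, cut]; tauto
  induction D1 using Multiset.induction_on with
  | empty =>
    intro D2 _ hD2 hcov
    have h0 : ∀ T ∈ D2, ∀ e ∈ M.cut B, e ∉ T := fun T hT e he =>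
      cov_zero_iff.1 ((hcov e he).symm.trans (by simp)) T hT
    refine ⟨D2, ?_, ?_, fun _ _ => rfl⟩
    · intro T hT
      refine ⟨(hD2 T hT).1.trans hE2, ?_⟩
      have := ev_glue (M := M) (B := B) (T1 := ∅) (T2 := T) (by simp) (hD2 T hT).1 (ev_empty _) (hD2 T hT).2 (by
        ext e
        have := h0 T hT e
        simp only [Set.mem_inter_iff, Set.mem_empty_iff_false]; tauto)
      simpa using this
    · intro e he
      rw [cov_zero, cov_zero_iff]
      intro T hT heT
      exact h0 T hT e (hcut e he ((hD2 T hT).1 heT)) heT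
  | cons T D1 ih =>
    intro D2 hD1 hD2 hcov
    have hT := hD1 T (Multiset.mem_cons_self _ _)
    have hD1' : ∀ T' ∈ D1, T' ⊆ (M.contr B).E ∧ (M.contr B).Ev T' := fun T' hT' =>
      hD1 T' (Multiset.mem_cons_of_mem hT')
    by_cases hne : (T ∩ M.cut B).Nonempty
    · obtain ⟨T2, hT2, htr⟩ := trace_match hB (D1 := T ::ₘ D1) (D2 := D2)
        (fun X hX => hevcut X ((hD1 X hX).1.trans hE1) ((ev_contr M B X).1 (hD1 X hX).2).2)
        (fun X hX => hevcut X ((hD2 X hX).1.trans hE2) (by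
          have := ((ev_contr M Bᶜ X).1 (hD2 X hX).2).2
          rwa [par, cr_compl] at this)) hcov (Multiset.mem_cons_self _ _) hne
      obtain ⟨D2', rfl⟩ := Multiset.exists_cons_of_mem hT2
      have hT2 := hD2 T2 (Multiset.mem_cons_self _ _)
      have htr' : ∀ e ∈ M.cut B, e ∈ T2 ↔ e ∈ T := by
        intro e he
        have := Set.ext_iff.1 htr e
        simp only [Set.mem_inter_iff] at this
        tauto
      obtain ⟨D, hD, hc1, hc2⟩ := ih D2' hD1' (fun X hX => hD2 X (Multiset.mem_cons_of_mem hX)) (by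
        intro e he
        have h3 := hcov e he
        rw [cov_cons, cov_cons] at h3
        simp only [htr' e he] at h3
        omega)
      refine ⟨(T ∪ T2) ::ₘ D, ?_, ?_, ?_⟩
      · intro X hX
        rcases Multiset.mem_cons.1 hX with rfl | hX
        · exact ⟨Set.union_subset (hT.1.trans hE1) (hT2.1.trans hE2),
            ev_glue hT.1 hT2.1 hT.2 hT2.2 htr.symm⟩
        · exact hD X hX
      · intro e he
        have : e ∈ T ∪ T2 ↔ e ∈ T := by
          refine ⟨?_, Or.inl⟩
          rintro (h | h)
          · exact h
          · exact (htr' e (hcut e he (hT2.1 h))).1 h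
        simp only [cov_cons, this, hc1 e he]
      · intro e he
        have : e ∈ T ∪ T2 ↔ e ∈ T2 := by
          refine ⟨?_, Or.inr⟩
          rintro (h | h)
          · exact (htr' e (hcut e (hT.1 h) he)).2 h
          · exact h
        simp only [cov_cons, this, hc2 e he]
    · rw [Set.not_nonempty_iff_eq_empty] at hne
      have hn : ∀ e ∈ M.cut B, e ∉ T := fun e he h => by
        have : e ∈ T ∩ M.cut B := ⟨h, he⟩
        rw [hne] at this; exact this
      obtain ⟨D, hD, hc1, hc2⟩ := ih D2 hD1' hD2 (by
        intro e he
        have h3 := hcov e he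
        rw [cov_cons, if_neg (hn e he)] at h3
        omega)
      refine ⟨T ::ₘ D, ?_, ?_, ?_⟩
      · intro X hX
        rcases Multiset.mem_cons.1 hX with rfl | hX
        · refine ⟨hT.1.trans hE1, ?_⟩
          have := ev_glue (M := M) (B := B) (T1 := X) (T2 := ∅) hT.1 (by simp) hT.2 (ev_empty _)
            (by rw [hne]; simp)
          simpa using this
        · exact hD X hX
      · intro e he
        simp only [cov_cons, hc1 e he]
      · intro e he
        have : e ∉ T := fun h => hn e (hcut e (hT.1 h) he) h
        simp only [cov_cons, this, hc2 e he, if_false, add_zero]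

lemma good_of_contr {M : MG W F} {B : Set W} (hB : (M.cut B).ncard ≤ 3) {C : Set F}
    (h1 : (M.contr B).Good (C ∩ (M.contr B).E)) (h2 : (M.contr Bᶜ).Good (C ∩ (M.contr Bᶜ).E)) :
    M.Good C := by
  obtain ⟨D1, hD1, hc1⟩ := h1
  obtain ⟨D2, hD2, hc2⟩ := h2
  have hc1' : ∀ e ∈ (M.contr B).E, cov D1 e + (if e ∈ C then 1 else 0) = 2 := by
    intro e he
    have := hc1 e he
    simpa only [Set.mem_inter_iff, he, and_true] using this
  have hc2' : ∀ e ∈ (M.contr Bᶜ).E, cov D2 e + (if e ∈ C then 1 else 0) = 2 := by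
    intro e he
    have := hc2 e he
    simpa only [Set.mem_inter_iff, he, and_true] using this
  obtain ⟨D, hD, h3, h4⟩ := glue_covers hB D1 D2 hD1 hD2 (by
    rintro e ⟨he1, he2⟩
    rw [mem_cr] at he2
    have h3 := hc1' e (mem_contr_E.2 ⟨he1, by tauto⟩)
    have h4 := hc2' e (mem_contr_E.2 ⟨he1, by simp only [Set.mem_compl_iff]; tauto⟩)
    omega)
  refine ⟨D, hD, ?_⟩
  intro e he
  by_cases h : e ∈ (M.contr B).E
  · rw [h3 e h]; exact hc1' e h
  · have h' : e ∈ (M.contr Bᶜ).E := by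
      rw [mem_contr_E] at h ⊢
      simp only [Set.mem_compl_iff]; tauto
    rw [h4 e h']; exact hc2' e h'

/-- abstract minimal counterexample -/
structure Mini (M : MG W F) (C : Set F) : Prop where
  lpl : M.Lpl
  brl : M.Brl
  inj : Set.InjOn M.ends M.E
  circ : M.Circ C
  ne : C.Nonempty
  bad : ¬ M.Good C
  small : ∀ (W' : Type) [Fintype W'] (M' : MG W' F), M'.Lpl → M'.Brl →
    Fintype.card W' < Fintype.card W → ∀ C', M'.Circ C' → M'.Good C'
  small' : ∀ (M' : MG W F), M'.Lpl → M'.Brl → M'.E.ncard < M.E.ncard →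
    ∀ C', M'.Circ C' → M'.Good C'

/-- R1 -/
lemma Mini.cut3 {M : MG W F} {C : Set F} (h : Mini M C) {A : Set W} (hA : 2 ≤ A.ncard)
    (hA' : 2 ≤ Aᶜ.ncard) : 4 ≤ (M.cut A).ncard := by
  by_contra hcon
  have hc : (M.cut A).ncard ≤ 3 := by omega
  have hc' : (M.cut Aᶜ).ncard ≤ 3 := by rw [cut_compl]; omega
  have n1 : A.Nonempty := Set.nonempty_of_ncard_ne_zero (by omega)
  have n2 : Aᶜ.Nonempty := Set.nonempty_of_ncard_ne_zero (by omega)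
  apply h.bad
  exact good_of_contr hc
    (h.small _ _ (h.lpl.contr A) (h.brl.contr n1) (card_contr hA) _ (circ_contr h.circ hc))
    (h.small _ _ (h.lpl.contr Aᶜ) (h.brl.contr n2) (card_contr hA') _ (circ_contr h.circ hc'))

end MG

namespace MG
variable {W F : Type} [Fintype W] [Fintype F]

/-- add `eb` to the sets containing `ea` -/
def lift (ea eb : F) (T : Set F) : Set F := {f | f ∈ T ∨ (f = eb ∧ ea ∈ T)}

lemma mem_lift {ea eb f : F} {T : Set F} : f ∈ lift ea eb T ↔ f ∈ T ∨ (f = eb ∧ ea ∈ T) := Iff.rfl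

lemma cov_lift {ea eb : F} {D : Multiset (Set F)} (h : ∀ T ∈ D, eb ∉ T) (f : F) :
    cov (D.map (lift ea eb)) f = if f = eb then cov D ea else cov D f := by
  induction D using Multiset.induction_on with
  | empty => simp
  | cons T D ih =>
    rw [Multiset.map_cons, cov_cons, ih fun T' hT' => h T' (Multiset.mem_cons_of_mem hT')]
    have := h T (Multiset.mem_cons_self _ _)
    by_cases hf : f = eb
    · subst hf; simp [mem_lift, this]
    · simp [mem_lift, hf]

lemma good_lift {W' : Type} [Fintype W'] {M : MG W F} {M' : MG W' F} {ea eb : F} (hea : ea ∈ M.E)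
    (hne : ea ≠ eb) (hebE : eb ∈ M.E) (hE : ∀ f, f ∈ M'.E ↔ f ∈ M.E ∧ f ≠ eb)
    (hev : ∀ T, T ⊆ M'.E → (M'.Ev T ↔ M.Ev (lift ea eb T))) {C : Set F} (hC : M.Circ C)
    (hCab : ea ∈ C ↔ eb ∈ C) (hall : ∀ C', M'.Circ C' → M'.Good C') : M.Good C := by
  have hlC : lift ea eb (C \ {eb}) = C := by
    ext f
    simp only [mem_lift, Set.mem_sdiff, Set.mem_singleton_iff]
    by_cases hf : f = eb
    · subst hf; simp only [not_true_eq_false, and_false, false_or, true_and]; tauto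
    · tauto
  have hsub : C \ {eb} ⊆ M'.E := fun f hf => (hE f).2 ⟨hC.1 hf.1, hf.2⟩
  have hC' : M'.Circ (C \ {eb}) := by
    refine ⟨hsub, (hev _ hsub).2 (by rw [hlC]; exact hC.2.1), ?_⟩
    intro T hT hTe
    have h1 := (hev T (hT.trans hsub)).1 hTe
    have h2 : lift ea eb T ⊆ C := by
      rintro f (h | ⟨rfl, h⟩)
      · exact (hT h).1
      · exact hCab.1 (hT h).1
    rcases hC.2.2 _ h2 h1 with h | h
    · left
      ext f; simp only [Set.mem_empty_iff_false, iff_false]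
      intro hf
      have : f ∈ lift ea eb T := Or.inl hf
      rw [h] at this; exact this
    · right
      apply Set.Subset.antisymm hT
      intro f hf
      have h3 := hf.1
      rw [← h] at h3
      rcases h3 with h3 | h3
      · exact h3
      · exact (hf.2 h3.1).elim
  obtain ⟨D, hD, hcov⟩ := hall _ hC'
  refine ⟨D.map (lift ea eb), ?_, ?_⟩
  · intro T hT
    obtain ⟨X, hX, rfl⟩ := Multiset.mem_map.1 hT
    refine ⟨?_, (hev X (hD X hX).1).1 (hD X hX).2⟩
    rintro f (h | ⟨rfl, h⟩)
    · exact ((hE f).1 ((hD X hX).1 h)).1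
    · exact hebE
  · intro f hf
    rw [cov_lift fun T hT h => ((hE eb).1 ((hD T hT).1 h)).2 rfl]
    by_cases hfb : f = eb
    · subst hfb
      have := hcov ea ((hE ea).2 ⟨hea, hne⟩)
      simp only [Set.mem_sdiff, Set.mem_singleton_iff, hne, not_false_eq_true, and_true, hCab] at this
      rw [if_pos rfl]; exact this
    · have := hcov f ((hE f).2 ⟨hf, hfb⟩)
      simp only [Set.mem_sdiff, Set.mem_singleton_iff, hfb, not_false_eq_true, and_true] at this
      rw [if_neg hfb]; exact this

lemma par_ends {M : MG W F} {e : F} {x y : W} (h : M.ends e = s(x, y)) (A : Set W) :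
    M.par {e} A = (if x ∈ A then 1 else 0) + (if y ∈ A then 1 else 0) := by
  rw [par_single]
  rcases Sym2.eq_iff.1 h with ⟨h1, h2⟩ | ⟨h1, h2⟩ <;> rw [h1, h2]
  rw [add_comm]

lemma zz (x : ZMod 2) : x + x = 0 := by revert x; decide

lemma lift_eq {ea eb : F} {T : Set F} (h : ea ∈ T) (hb : eb ∉ T) : lift ea eb T = T ∆ {eb} := by
  ext f
  simp only [mem_lift, Set.mem_symmDiff, Set.mem_singleton_iff]
  by_cases hf : f = eb
  · subst hf; tauto
  · tauto

lemma lift_eq' {ea eb : F} {T : Set F} (h : ea ∉ T) : lift ea eb T = T := by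
  ext f
  simp only [mem_lift]; tauto

lemma exists_other {M : MG W F} (hl : M.Lpl) {e : F} {v : W} (h : e ∈ M.cut {v}) :
    ∃ a, a ≠ v ∧ M.ends e = s(v, a) := by
  have h1 := hl e h.1
  have h2 := (mem_cr_single h1 v).1 h.2
  rw [ends, Sym2.mem_iff] at h2
  rcases h2 with h2 | h2
  · exact ⟨M.t e, by rw [h2]; exact h1.symm, by rw [ends, h2]⟩
  · exact ⟨M.s e, by rw [h2]; exact h1, by rw [ends, h2, Sym2.eq_swap]⟩

lemma Mini.deg_ne_two {M : MG W F} {C : Set F} (h : Mini M C) (v : W) : (M.cut {v}).ncard ≠ 2 := by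
  intro h2
  obtain ⟨e1, e2, hne, hcut⟩ := Set.ncard_eq_two.1 h2
  have he1 : e1 ∈ M.cut {v} := by rw [hcut]; simp
  have he2 : e2 ∈ M.cut {v} := by rw [hcut]; simp
  obtain ⟨a, hav, ha⟩ := exists_other h.lpl he1
  set B : Set W := {v, a} with hB
  have hBc : 2 ≤ B.ncard := by rw [hB, Set.ncard_pair hav.symm]
  have hcrv : ∀ f, f ∈ M.E → f ∈ M.cr {v} → f = e1 ∨ f = e2 := by
    intro f h3 h4
    have : f ∈ M.cut {v} := ⟨h3, h4⟩
    rw [hcut] at this; exact this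
  have hE : ∀ f, f ∈ (M.contr B).E ↔ f ∈ M.E ∧ f ≠ e1 := by
    intro f
    rw [mem_contr_E]
    constructor
    · rintro ⟨h3, h4⟩
      refine ⟨h3, ?_⟩
      rintro rfl
      apply h4
      rcases Sym2.eq_iff.1 ha with ⟨h5, h6⟩ | ⟨h5, h6⟩ <;> simp [hB, h5, h6]
    · rintro ⟨h3, h4⟩
      refine ⟨h3, ?_⟩
      rintro ⟨h5, h6⟩
      apply h4
      apply h.inj h3 he1.1
      rw [ha, ends]
      have h7 := h.lpl f h3
      simp only [hB, Set.mem_insert_iff, Set.mem_singleton_iff] at h5 h6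
      rcases h5 with h5 | h5 <;> rcases h6 with h6 | h6
      · exact (h7 (h5.trans h6.symm)).elim
      · rw [h5, h6]
      · rw [h5, h6, Sym2.eq_swap]
      · exact (h7 (h5.trans h6.symm)).elim
  have hpB : ∀ T, M.par T B = M.par T {v} + M.par T {a} := by
    intro T
    rw [par_sum, ← Finset.sum_subset (Finset.subset_univ {v, a}), Finset.sum_pair hav.symm]
    · simp [hB]
    · intro x _ hx
      simp only [Finset.mem_insert, Finset.mem_singleton] at hx
      rw [if_neg]; simpa [hB] using hx
  have hCab : e2 ∈ C ↔ e1 ∈ C := by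
    have h3 := h.circ.2.1 v
    by_contra hcon
    have h4 : (C ∩ M.cr {v}).ncard = 1 := by
      rw [Set.ncard_eq_one]
      by_cases h5 : e1 ∈ C
      · refine ⟨e1, ?_⟩
        ext f; simp only [Set.mem_inter_iff, Set.mem_singleton_iff]
        constructor
        · rintro ⟨h6, h7⟩
          rcases hcrv f (h.circ.1 h6) h7 with rfl | rfl
          · rfl
          · tauto
        · rintro rfl; exact ⟨h5, he1.2⟩
      · refine ⟨e2, ?_⟩
        ext f; simp only [Set.mem_inter_iff, Set.mem_singleton_iff]
        constructor
        · rintro ⟨h6, h7⟩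
          rcases hcrv f (h.circ.1 h6) h7 with rfl | rfl
          · tauto
          · rfl
        · rintro rfl; exact ⟨by tauto, he2.2⟩
    rw [h4] at h3
    exact absurd h3 (by decide)
  apply h.bad
  refine good_lift (M' := M.contr B) (ea := e2) (eb := e1) he2.1 hne.symm he1.1 hE ?_ h.circ hCab
    (h.small _ _ (h.lpl.contr B) (h.brl.contr ⟨v, by simp [hB]⟩) (card_contr hBc))
  intro T hT
  have hTE : T ⊆ M.E := fun f hf => ((hE f).1 (hT hf)).1
  have he1T : e1 ∉ T := fun h => ((hE e1).1 (hT h)).2 rfl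
  have hpv : M.par (lift e2 e1 T) {v} = 0 := by
    rw [par_eq_zero]
    by_cases h3 : e2 ∈ T
    · have : lift e2 e1 T ∩ M.cr {v} = {e1, e2} := by
        ext f; simp only [Set.mem_inter_iff, mem_lift, Set.mem_insert_iff, Set.mem_singleton_iff]
        constructor
        · rintro ⟨h4 | h4, h5⟩
          · exact hcrv f (hTE h4) h5
          · exact Or.inl h4.1
        · rintro (rfl | rfl)
          · exact ⟨Or.inr ⟨rfl, h3⟩, he1.2⟩
          · exact ⟨Or.inl h3, he2.2⟩
      rw [this, Set.ncard_pair hne]; decide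
    · have : lift e2 e1 T ∩ M.cr {v} = ∅ := by
        rw [lift_eq' h3]
        ext f; simp only [Set.mem_inter_iff, Set.mem_empty_iff_false, iff_false]
        rintro ⟨h4, h5⟩
        rcases hcrv f (hTE h4) h5 with rfl | rfl
        · exact he1T h4
        · exact h3 h4
      rw [this]; simp
  have hpX : ∀ X : Set W, (v ∈ X ↔ a ∈ X) → M.par (lift e2 e1 T) X = M.par T X := by
    intro X hX
    by_cases h3 : e2 ∈ T
    · rw [lift_eq h3 he1T, par_symmDiff, par_ends ha]
      simp only [hX, zz, add_zero]
    · rw [lift_eq' h3]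
  rw [ev_contr, ev_iff]
  constructor
  · rintro ⟨h3, h4⟩ u
    by_cases hu : u = v
    · rw [hu]; exact hpv
    by_cases hua : u = a
    · rw [← hpX B (by simp [hB]), hpB, hpv, zero_add] at h4
      rw [hua]; exact h4
    · rw [hpX]
      · exact h3 u (by simp [hB, hu, hua])
      · simp [Ne.symm hu, Ne.symm hua]
  · intro h3
    constructor
    · intro u hu
      rw [← hpX]
      · exact h3 u
      · simp only [hB, Set.mem_insert_iff, Set.mem_singleton_iff, not_or] at hu
        simp [Ne.symm hu.1, Ne.symm hu.2]
    · rw [← hpX B (by simp [hB]), hpB, h3, h3, add_zero]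

/-- splitting off `ea = va` and `eb = vb` into a single edge `ab` (labelled `ea`) -/
noncomputable def split (M : MG W F) (ea eb : F) (a b : W) : MG W F :=
  ⟨Function.update M.s ea a, Function.update M.t ea b, M.E \ {eb}⟩

lemma cr_split {M : MG W F} {ea eb : F} {a b : W} {f : F} (hf : f ≠ ea) (A : Set W) :
    f ∈ (M.split ea eb a b).cr A ↔ f ∈ M.cr A := by
  simp [mem_cr, split, Function.update_of_ne hf]

lemma cr_split' {M : MG W F} {ea eb : F} {a b : W} (A : Set W) :
    ea ∈ (M.split ea eb a b).cr A ↔ ¬ (a ∈ A ↔ b ∈ A) := by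
  simp [mem_cr, split]

lemma par_split {M : MG W F} {ea eb : F} {v a b : W} (ha : M.ends ea = s(v, a))
    (hb : M.ends eb = s(v, b)) {T : Set F} (hT : eb ∉ T) (A : Set W) :
    (M.split ea eb a b).par T A = M.par (lift ea eb T) A := by
  have h0 : ∀ S : Set F, ea ∉ S → (M.split ea eb a b).par S A = M.par S A := by
    intro S hS
    have : S ∩ (M.split ea eb a b).cr A = S ∩ M.cr A := by
      ext f
      simp only [Set.mem_inter_iff]
      by_cases hf : f = ea
      · subst hf; tauto
      · rw [cr_split hf]
    simp [par, this]
  by_cases h : ea ∈ T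
  · have hT' : T = (T \ {ea}) ∆ {ea} := by
      ext f
      simp only [Set.mem_symmDiff, Set.mem_sdiff, Set.mem_singleton_iff]
      by_cases hf : f = ea
      · subst hf; tauto
      · tauto
    rw [lift_eq h hT, par_symmDiff]
    rw [hT', par_symmDiff, par_symmDiff, h0 _ (by simp), par_ends ha, par_ends hb,
      par_ends (M := M.split ea eb a b) (x := a) (y := b) (by simp [ends, split])]
    have : ∀ p x y z : ZMod 2, p + (x + y) = p + (z + x) + (z + y) := by decide
    exact this _ _ _ _
  · rw [lift_eq' h, h0 T h]

lemma Mini.deg_lt_four {M : MG W F} {C : Set F} (h : Mini M C) (v : W) : (M.cut {v}).ncard < 4 := by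
  by_contra hcon
  have h4 : 4 ≤ (M.cut {v}).ncard := by omega
  have hpick : ∃ ea eb, ea ∈ M.cut {v} ∧ eb ∈ M.cut {v} ∧ ea ≠ eb ∧ (ea ∈ C ↔ eb ∈ C) := by
    by_cases hne : (C ∩ M.cr {v}).Nonempty
    · have h1 := (Set.ncard_pos (Set.toFinite _)).2 hne
      obtain ⟨k, hk⟩ := h.circ.2.1 v
      obtain ⟨x, y, hx, hy, hxy⟩ := (Set.one_lt_ncard_iff (Set.toFinite _)).1 (show 1 < (C ∩ M.cr {v}).ncard by omega)
      exact ⟨x, y, ⟨h.circ.1 hx.1, hx.2⟩, ⟨h.circ.1 hy.1, hy.2⟩, hxy, by simp [hx.1, hy.1]⟩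
    · obtain ⟨x, y, hx, hy, hxy⟩ := (Set.one_lt_ncard_iff (Set.toFinite _)).1 (show 1 < (M.cut {v}).ncard by omega)
      have : ∀ z ∈ M.cut {v}, z ∉ C := fun z hz hzC => hne ⟨z, hzC, hz.2⟩
      exact ⟨x, y, hx, hy, hxy, by simp [this x hx, this y hy]⟩
  obtain ⟨ea, eb, hea, heb, hne, hCab⟩ := hpick
  obtain ⟨a, hav, ha⟩ := exists_other h.lpl hea
  obtain ⟨b, hbv, hb⟩ := exists_other h.lpl heb
  have hab : a ≠ b := by
    rintro rfl
    exact hne (h.inj hea.1 heb.1 (ha.trans hb.symm))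
  have hE : ∀ f, f ∈ (M.split ea eb a b).E ↔ f ∈ M.E ∧ f ≠ eb := fun f => Iff.rfl
  have hl : (M.split ea eb a b).Lpl := by
    rintro f ⟨hf, -⟩
    by_cases hfa : f = ea
    · subst hfa; simpa [split] using hab
    · simp only [split, Function.update_of_ne hfa]; exact h.lpl f hf
  have hbr0 : ∀ X : Set W, X.Nonempty → v ∉ X → 2 ≤ ((M.split ea eb a b).cut X).ncard := by
    intro X hX hvX
    have hcX := h.brl X hX ⟨v, hvX⟩
    have hac : ea ∈ M.cr X ↔ a ∈ X := by rw [mem_cr_ends ha]; tauto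
    have hbc : eb ∈ M.cr X ↔ b ∈ X := by rw [mem_cr_ends hb]; tauto
    have hmem : ∀ f, f ≠ ea → f ≠ eb → f ∈ M.cut X → f ∈ (M.split ea eb a b).cut X :=
      fun f h1 h2 h3 => ⟨⟨h3.1, h2⟩, (cr_split h1 X).2 h3.2⟩
    have hmea : ¬ (a ∈ X ↔ b ∈ X) → ea ∈ (M.split ea eb a b).cut X := fun h1 =>
      ⟨⟨hea.1, hne⟩, (cr_split' X).2 h1⟩
    by_cases haX : a ∈ X <;> by_cases hbX : b ∈ X
    · by_contra hlt
      have h1 : M.cut X ⊆ insert ea (insert eb ((M.split ea eb a b).cut X)) := by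
        intro f hf
        simp only [Set.mem_insert_iff]
        by_cases h1 : f = ea
        · exact Or.inl h1
        by_cases h2 : f = eb
        · exact Or.inr (Or.inl h2)
        exact Or.inr (Or.inr (hmem f h1 h2 hf))
      have h2 := Set.ncard_le_ncard h1
      have h3 := Set.ncard_insert_le ea (insert eb ((M.split ea eb a b).cut X))
      have h5 := Set.ncard_insert_le eb ((M.split ea eb a b).cut X)
      have h6 : (M.cut X).ncard ≤ 3 := by omega
      have h7 : 2 ≤ X.ncard := by
        rw [← Set.ncard_pair hab]
        refine Set.ncard_le_ncard ?_
        rintro x (rfl | rfl) <;> assumption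
      have h8 : 2 ≤ Xᶜ.ncard := by
        by_contra hlt'
        have h9 : Xᶜ = {v} := by
          symm
          apply Set.eq_of_subset_of_ncard_le (by simpa using hvX)
          rw [Set.ncard_singleton]; omega
        rw [← cut_compl, h9] at h6
        omega
      have := h.cut3 h7 h8
      omega
    · refine hcX.trans (Set.ncard_le_ncard ?_)
      intro f hf
      by_cases h1 : f = ea
      · subst h1; exact hmea (by tauto)
      · exact hmem f h1 (by rintro rfl; exact hbX (hbc.1 hf.2)) hf
    · refine hcX.trans ?_
      have hebX : eb ∈ M.cut X := ⟨heb.1, hbc.2 hbX⟩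
      have h1 : insert ea (M.cut X \ {eb}) ⊆ (M.split ea eb a b).cut X := by
        rintro f (rfl | ⟨hf, hf'⟩)
        · exact hmea (by tauto)
        · exact hmem f (by rintro rfl; exact haX (hac.1 hf.2)) hf' hf
      refine le_trans ?_ (Set.ncard_le_ncard h1)
      rw [Set.ncard_insert_of_notMem (fun h => haX (hac.1 h.1.2)), Set.ncard_sdiff_singleton_add_one hebX]
    · refine hcX.trans (Set.ncard_le_ncard ?_)
      intro f hf
      exact hmem f (by rintro rfl; exact haX (hac.1 hf.2)) (by rintro rfl; exact hbX (hbc.1 hf.2)) hf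
  have hbr : (M.split ea eb a b).Brl := by
    intro X hX hX'
    by_cases hvX : v ∈ X
    · rw [← cut_compl]; exact hbr0 _ hX' (by simpa using hvX)
    · exact hbr0 X hX hvX
  apply h.bad
  refine good_lift (M' := M.split ea eb a b) (ea := ea) (eb := eb) hea.1 hne heb.1 hE ?_ h.circ hCab
    (h.small' _ hl hbr ?_)
  · intro T hT
    rw [ev_iff, ev_iff]
    have : eb ∉ T := fun h => (hT h).2 rfl
    simp only [par_split ha hb this]
  · exact Set.ncard_lt_ncard (Set.sdiff_singleton_ssubset.2 heb.1)

lemma Mini.cubic {M : MG W F} {C : Set F} (h : Mini M C) (v : W) : (M.cut {v}).ncard = 3 := by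
  have h1 := h.deg_ne_two v
  have h2 := h.deg_lt_four v
  have h3 : 2 ≤ (M.cut {v}).ncard := by
    apply h.brl {v} (Set.singleton_nonempty v)
    obtain ⟨e, he⟩ := h.ne
    have := h.lpl e (h.circ.1 he)
    by_contra hcon
    rw [Set.not_nonempty_iff_eq_empty, Set.compl_empty_iff] at hcon
    have h4 : ∀ x : W, x = v := fun x => by
      have : x ∈ ({v} : Set W) := by rw [hcon]; trivial
      exact this
    exact this ((h4 _).trans (h4 _).symm)
  omega

lemma good_of_col {M : MG W F} {A B C : Set F} (hA : A ⊆ M.E) (hB : B ⊆ M.E) (hA' : M.Ev A)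
    (hB' : M.Ev B) (hAB : M.E ⊆ A ∪ B) (hC : M.Circ C) : M.Good C := by
  refine ⟨(C ∆ A) ::ₘ (C ∆ B) ::ₘ (C ∆ (A ∆ B)) ::ₘ 0, ?_, ?_⟩
  · have hs : ∀ S T : Set F, S ⊆ M.E → T ⊆ M.E → S ∆ T ⊆ M.E := by
      rintro S T h1 h2 f (h | h)
      · exact h1 h.1
      · exact h2 h.1
    intro T hT
    simp only [Multiset.mem_cons, Multiset.notMem_zero, or_false] at hT
    rcases hT with rfl | rfl | rfl
    · exact ⟨hs _ _ hC.1 hA, hC.2.1.symmDiff hA'⟩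
    · exact ⟨hs _ _ hC.1 hB, hC.2.1.symmDiff hB'⟩
    · exact ⟨hs _ _ hC.1 (hs _ _ hA hB), hC.2.1.symmDiff (hA'.symmDiff hB')⟩
  · intro e he
    have := hAB he
    simp only [Set.mem_union] at this
    simp only [cov_cons, cov_zero, Set.mem_symmDiff]
    by_cases h1 : e ∈ A <;> by_cases h2 : e ∈ B <;> by_cases h3 : e ∈ C <;> simp_all

lemma Mini.uncol {M : MG W F} {C : Set F} (h : Mini M C) (c : F → Fin 3) :
    ∃ v, ∃ e1 ∈ M.cut {v}, ∃ e2 ∈ M.cut {v}, e1 ≠ e2 ∧ c e1 = c e2 := by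
  by_contra hcon
  push Not at hcon
  have key : ∀ i : Fin 3, M.Ev {e ∈ M.E | c e ≠ i} := by
    intro i v
    obtain ⟨x, y, z, hxy, hxz, hyz, hcut⟩ := Set.ncard_eq_three.1 (h.cubic v)
    have hm : ∀ f, (f = x ∨ f = y ∨ f = z) → f ∈ M.cut {v} := by intro f hf; rw [hcut]; exact hf
    have hx := hm x (by simp)
    have hy := hm y (by simp)
    have hz := hm z (by simp)
    rw [even_triple (E := M.E) (fun e he => he.1) hcut hxy hxz hyz]
    have h1 := hcon v x hx y hy hxy
    have h2 := hcon v x hx z hz hxz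
    have h3 := hcon v y hy z hz hyz
    simp only [Set.mem_ofPred_eq, hx.1, hy.1, hz.1, true_and]
    revert h1 h2 h3
    generalize c x = p
    generalize c y = q
    generalize c z = r
    revert p q r i
    decide
  apply h.bad
  refine good_of_col (A := {e ∈ M.E | c e ≠ 0}) (B := {e ∈ M.E | c e ≠ 1}) (fun e he => he.1)
    (fun e he => he.1) (key 0) (key 1) ?_ h.circ
  intro e he
  simp only [Set.mem_union, Set.mem_ofPred_eq, he, true_and]
  generalize c e = p
  revert p; decide

lemma Circ.cross {M : MG W F} {C : Set F} (hC : M.Circ C) {X : Set W} {x y : W} (hx : x ∈ X)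
    (hy : y ∉ X) (hxC : (C ∩ M.cr {x}).Nonempty) (hyC : (C ∩ M.cr {y}).Nonempty) :
    2 ≤ (C ∩ M.cr X).ncard := by
  by_contra hcon
  have h0 : C ∩ M.cr X = ∅ := by
    obtain ⟨k, hk⟩ := hC.2.1.cut X
    rw [← Set.ncard_eq_zero (Set.toFinite _)]; omega
  have hst : ∀ e ∈ C, (M.s e ∈ X ↔ M.t e ∈ X) := by
    intro e he
    by_contra h
    have : e ∈ C ∩ M.cr X := ⟨he, h⟩
    rw [h0] at this; exact this
  have hin : ∀ e ∈ C, ∀ v, e ∈ M.cr {v} → (M.s e ∈ X ↔ v ∈ X) := by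
    intro e he v hv
    rw [mem_cr] at hv
    simp only [Set.mem_singleton_iff] at hv
    by_cases h1 : M.s e = v
    · rw [h1]
    · by_cases h2 : M.t e = v
      · rw [hst e he, h2]
      · tauto
  have hev : M.Ev {e ∈ C | M.s e ∈ X} := by
    intro v
    by_cases hv : v ∈ X
    · convert hC.2.1 v using 2
      ext e
      have := fun h1 h2 => hin e h1 v h2
      simp only [Set.mem_inter_iff, Set.mem_ofPred_eq]
      tauto
    · have : {e ∈ C | M.s e ∈ X} ∩ M.cr {v} = ∅ := by
        ext e
        have := fun h1 h2 => hin e h1 v h2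
        simp only [Set.mem_inter_iff, Set.mem_ofPred_eq, Set.mem_empty_iff_false]
        tauto
      rw [this]; simp
  obtain ⟨e, heC, hex⟩ := hxC
  obtain ⟨f, hfC, hfy⟩ := hyC
  rcases hC.2.2 _ (fun e he => he.1) hev with h | h
  · have : e ∈ {e ∈ C | M.s e ∈ X} := ⟨heC, (hin e heC x hex).2 hx⟩
    rw [h] at this; exact this
  · rw [← h] at hfC
    exact hy ((hin f hfC.1 y hfy).1 hfC.2)

/-- R4 -/
lemma Mini.stable {M : MG W F} {C : Set F} (h : Mini M C) {C' : Set F} (hC' : M.Circ C')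
    (hv : ∀ v, (C ∩ M.cr {v}).Nonempty → (C' ∩ M.cr {v}).Nonempty) : C' = C := by
  by_contra hne
  have hS : (C \ C').Nonempty := by
    by_contra hcon
    rw [Set.not_nonempty_iff_eq_empty, Set.sdiff_eq_empty] at hcon
    rcases hC'.2.2 C hcon h.circ.2.1 with h1 | h1
    · have := h.ne; rw [h1] at this; exact Set.not_nonempty_empty this
    · exact hne h1.symm
  have hbr : (M.del (C \ C')).Brl := by
    intro X hX hX'
    rw [cut_del]
    by_cases hc : ∃ e ∈ C \ C', e ∈ M.cr X
    · obtain ⟨e, he, hec⟩ := hc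
      have hl := h.lpl e (h.circ.1 he.1)
      have hs : (C' ∩ M.cr {M.s e}).Nonempty := hv _ ⟨e, he.1, by rw [mem_cr_single hl]; simp [ends]⟩
      have ht : (C' ∩ M.cr {M.t e}).Nonempty := hv _ ⟨e, he.1, by rw [mem_cr_single hl]; simp [ends]⟩
      have h2 : 2 ≤ (C' ∩ M.cr X).ncard := by
        rw [mem_cr] at hec
        by_cases h3 : M.s e ∈ X
        · exact hC'.cross h3 (by tauto) hs ht
        · exact hC'.cross (x := M.t e) (y := M.s e) (by tauto) h3 ht hs
      refine h2.trans (Set.ncard_le_ncard ?_)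
      exact fun f hf => ⟨⟨hC'.1 hf.1, hf.2⟩, fun h => h.2 hf.1⟩
    · push Not at hc
      refine (h.brl X hX hX').trans (Set.ncard_le_ncard ?_)
      exact fun f hf => ⟨hf, fun h => hc f h hf.2⟩
  have hE : (M.del (C \ C')).E.ncard < M.E.ncard := by
    obtain ⟨e, he⟩ := hS
    refine Set.ncard_lt_ncard ?_
    exact ⟨Set.sdiff_subset, fun h' => (h' (h.circ.1 he.1)).2 he⟩
  obtain ⟨D, hD, hcov⟩ := h.small' _ (h.lpl.del _) hbr hE C' (circ_del hC' fun e he h => h.2 he)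
  apply h.bad
  refine ⟨(C ∆ C') ::ₘ D, ?_, ?_⟩
  · intro T hT
    rcases Multiset.mem_cons.1 hT with rfl | hT
    · refine ⟨?_, h.circ.2.1.symmDiff hC'.2.1⟩
      rintro f (hf | hf)
      · exact h.circ.1 hf.1
      · exact hC'.1 hf.1
    · exact ⟨fun f hf => ((hD T hT).1 hf).1, (hD T hT).2⟩
  · intro e he
    by_cases heS : e ∈ C \ C'
    · have : cov D e = 0 := cov_zero_iff.2 fun X hX h => ((hD X hX).1 h).2 heS
      simp [this, Set.mem_symmDiff, heS.1, heS.2]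
    · have := hcov e ⟨he, heS⟩
      rw [Set.mem_sdiff] at heS
      by_cases h1 : e ∈ C <;> by_cases h2 : e ∈ C' <;> simp_all [Set.mem_symmDiff]

end MG

namespace MG
variable {W F : Type} [Fintype W] [Fintype F]

/-- a four-cycle in a cubic graph -/
structure Quad (M : MG W F) (a b c d : W) (ab bc cd da pa pb pc pd : F) : Prop where
  cuta : M.cut {a} = {ab, da, pa}
  cutb : M.cut {b} = {bc, ab, pb}
  cutc : M.cut {c} = {cd, bc, pc}
  cutd : M.cut {d} = {da, cd, pd}
  vab : a ≠ b
  vac : a ≠ c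
  vad : a ≠ d
  vbc : b ≠ c
  vbd : b ≠ d
  vcd : c ≠ d
  eab : M.ends ab = s(a, b)
  ebc : M.ends bc = s(b, c)
  ecd : M.ends cd = s(c, d)
  eda : M.ends da = s(d, a)
  nd : [ab, bc, cd, da, pa, pb, pc, pd].Nodup

variable {M : MG W F} {C : Set F} {a b c d : W} {ab bc cd da pa pb pc pd : F}

lemma Quad.rot (q : Quad M a b c d ab bc cd da pa pb pc pd) :
    Quad M b c d a bc cd da ab pb pc pd pa where
  cuta := q.cutb
  cutb := q.cutc
  cutc := q.cutd
  cutd := q.cuta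
  vab := q.vbc
  vac := q.vbd
  vad := q.vab.symm
  vbc := q.vcd
  vbd := q.vac.symm
  vcd := q.vad.symm
  eab := q.ebc
  ebc := q.ecd
  ecd := q.eda
  eda := q.eab
  nd := by
    have := q.nd
    simp only [List.nodup_cons, List.mem_cons, List.not_mem_nil, or_false, not_or] at this ⊢
    grind

lemma Quad.refl (q : Quad M a b c d ab bc cd da pa pb pc pd) :
    Quad M a d c b da cd bc ab pa pd pc pb where
  cuta := by rw [q.cuta, Set.insert_comm]
  cutb := by rw [q.cutd, Set.insert_comm]
  cutc := by rw [q.cutc, Set.insert_comm]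
  cutd := by rw [q.cutb, Set.insert_comm]
  vab := q.vad
  vac := q.vac
  vad := q.vab
  vbc := q.vcd.symm
  vbd := q.vbd.symm
  vcd := q.vbc.symm
  eab := by rw [q.eda, Sym2.eq_swap]
  ebc := by rw [q.ecd, Sym2.eq_swap]
  ecd := by rw [q.ebc, Sym2.eq_swap]
  eda := by rw [q.eab, Sym2.eq_swap]
  nd := by
    have := q.nd
    simp only [List.nodup_cons, List.mem_cons, List.not_mem_nil, or_false, not_or] at this ⊢
    grind

lemma Quad.even_a (q : Quad M a b c d ab bc cd da pa pb pc pd) {T : Set F} (hTE : T ⊆ M.E)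
    (hT : M.Ev T) : ((ab ∈ T ∧ da ∈ T ∧ pa ∉ T) ∨ (ab ∈ T ∧ da ∉ T ∧ pa ∈ T) ∨
      (ab ∉ T ∧ da ∈ T ∧ pa ∈ T) ∨ (ab ∉ T ∧ da ∉ T ∧ pa ∉ T)) := by
  have := q.nd
  simp only [List.nodup_cons, List.mem_cons, List.not_mem_nil, or_false, not_or] at this
  exact (even_triple hTE q.cuta (by grind) (by grind) (by grind)).1 (hT a)

lemma par_ends' {M : MG W F} {e : F} {x y : W} (h : M.ends e = s(x, y)) (v : W) :
    M.par {e} {v} = (if v = x then 1 else 0) + (if v = y then 1 else 0) := by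
  rw [par_ends h]
  congr 1 <;> simp [eq_comm]

lemma Quad.evQ (q : Quad M a b c d ab bc cd da pa pb pc pd) : M.Ev ({ab, bc, cd, da} : Set F) := by
  have hQ : ({ab, bc, cd, da} : Set F) = ((({ab} ∆ {bc}) ∆ {cd}) ∆ {da} : Set F) := by
    have := q.nd
    simp only [List.nodup_cons, List.mem_cons, List.not_mem_nil, or_false, not_or] at this
    ext f
    simp only [Set.mem_symmDiff, Set.mem_insert_iff, Set.mem_singleton_iff]
    grind
  rw [hQ, ev_iff]
  intro v
  simp only [par_symmDiff, par_ends' q.eab, par_ends' q.ebc, par_ends' q.ecd, par_ends' q.eda]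
  generalize (if v = a then (1 : ZMod 2) else 0) = x
  generalize (if v = b then (1 : ZMod 2) else 0) = y
  generalize (if v = c then (1 : ZMod 2) else 0) = z
  generalize (if v = d then (1 : ZMod 2) else 0) = w
  revert x y z w; decide

lemma Quad.memE (q : Quad M a b c d ab bc cd da pa pb pc pd) :
    ab ∈ M.E ∧ bc ∈ M.E ∧ cd ∈ M.E ∧ da ∈ M.E := by
  refine ⟨?_, ?_, ?_, ?_⟩
  · have : ab ∈ M.cut {a} := by rw [q.cuta]; simp
    exact this.1
  · have : bc ∈ M.cut {b} := by rw [q.cutb]; simp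
    exact this.1
  · have : cd ∈ M.cut {c} := by rw [q.cutc]; simp
    exact this.1
  · have : da ∈ M.cut {d} := by rw [q.cutd]; simp
    exact this.1

lemma Quad.subQ (q : Quad M a b c d ab bc cd da pa pb pc pd) : ({ab, bc, cd, da} : Set F) ⊆ M.E := by
  obtain ⟨h1, h2, h3, h4⟩ := q.memE
  rintro f (rfl | rfl | rfl | rfl) <;> assumption

lemma Mini.small_cut (h : Mini M C) {X : Set W} (h1 : X.Nonempty) (h2 : Xᶜ.Nonempty)
    (hc : (M.cut X).ncard ≤ 3) : ∃ x, X = {x} ∨ Xᶜ = {x} := by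
  have p1 := (Set.ncard_pos (Set.toFinite _)).2 h1
  have p2 := (Set.ncard_pos (Set.toFinite _)).2 h2
  by_cases h3 : 2 ≤ X.ncard
  · by_cases h4 : 2 ≤ Xᶜ.ncard
    · have := h.cut3 h3 h4; omega
    · obtain ⟨x, hx⟩ := Set.ncard_eq_one.1 (show Xᶜ.ncard = 1 by omega)
      exact ⟨x, Or.inr hx⟩
  · obtain ⟨x, hx⟩ := Set.ncard_eq_one.1 (show X.ncard = 1 by omega)
    exact ⟨x, Or.inl hx⟩

lemma Mini.brl_del (h : Mini M C) {S : Set F} (hS : S.ncard ≤ 2)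
    (hS' : ∀ x, ∀ e ∈ S, ∀ f ∈ S, e ∈ M.cr {x} → f ∈ M.cr {x} → e = f) : (M.del S).Brl := by
  intro X h1 h2
  rw [cut_del]
  by_contra hcon
  have h3 := Set.ncard_le_ncard_sdiff_add_ncard (M.cut X) S
  obtain ⟨x, hx⟩ := h.small_cut h1 h2 (by omega)
  have h4 : M.cut X = M.cut {x} := by
    rcases hx with hx | hx
    · rw [hx]
    · rw [← cut_compl, hx]
  rw [h4] at hcon
  have h5 := h.cubic x
  have h6 : (M.cut {x} ∩ S).ncard ≤ 1 := by
    rw [Set.ncard_le_one_iff]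
    rintro e f ⟨he, he'⟩ ⟨hf, hf'⟩
    exact hS' x e he' f hf' he.2 hf.2
  have h7 := Set.ncard_inter_add_ncard_sdiff_eq_ncard (M.cut {x}) S
  omega

lemma Quad.del2 (q : Quad M a b c d ab bc cd da pa pb pc pd) (h : Mini M C) :
    (M.del {ab, cd}).Brl ∧ (M.del {ab, cd}).E.ncard < M.E.ncard := by
  have hm := q.memE
  constructor
  · apply h.brl_del (by
      have := Set.ncard_insert_le ab ({cd} : Set F)
      rwa [Set.ncard_singleton] at this)
    have key : ∀ x, ab ∈ M.cr {x} → cd ∈ M.cr {x} → False := by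
      intro x h1 h2
      rw [mem_cr_ends q.eab] at h1
      rw [mem_cr_ends q.ecd] at h2
      simp only [Set.mem_singleton_iff] at h1 h2
      have := q.vac; have := q.vad; have := q.vbc; have := q.vbd
      grind
    rintro x e (rfl | rfl) f (rfl | rfl) h1 h2
    · rfl
    · exact (key x h1 h2).elim
    · exact (key x h2 h1).elim
    · rfl
  · refine Set.ncard_lt_ncard ⟨Set.sdiff_subset, fun h' => (h' hm.1).2 (by simp)⟩

lemma Quad.del1 (q : Quad M a b c d ab bc cd da pa pb pc pd) (h : Mini M C) :
    (M.del {cd}).Brl ∧ (M.del {cd}).E.ncard < M.E.ncard := by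
  have hm := q.memE
  constructor
  · apply h.brl_del (by simp)
    rintro x e rfl f rfl _ _; rfl
  · refine Set.ncard_lt_ncard ⟨Set.sdiff_subset, fun h' => (h' hm.2.2.1).2 (by simp)⟩

lemma symmDiff_sub {S T E : Set F} (h1 : S ⊆ E) (h2 : T ⊆ E) : S ∆ T ⊆ E := by
  rintro f (h | h)
  · exact h1 h.1
  · exact h2 h.1

/-- Case I -/
lemma Quad.case_opp (q : Quad M a b c d ab bc cd da pa pb pc pd) (h : Mini M C) :
    ¬ (ab ∉ C ∧ cd ∉ C) := by
  rintro ⟨hab, hcd⟩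
  obtain ⟨hb, hE⟩ := q.del2 h
  have hm := q.memE
  have nd := q.nd
  simp only [List.nodup_cons, List.mem_cons, List.not_mem_nil, or_false, not_or] at nd
  obtain ⟨D, hD, hcov⟩ := h.small' _ (h.lpl.del _) hb hE C (circ_del h.circ (by
    rintro e he (rfl | rfl) <;> tauto))
  have hda := hcov da ⟨hm.2.2.2, by simp; grind⟩
  have hbc := hcov bc ⟨hm.2.1, by simp; grind⟩
  have hsel : ∃ X Y D2, (∀ T ∈ X ::ₘ Y ::ₘ D2, T ⊆ (M.del {ab, cd}).E ∧ M.Ev T) ∧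
      (∀ e ∈ (M.del {ab, cd}).E, cov (X ::ₘ Y ::ₘ D2) e + (if e ∈ C then 1 else 0) = 2) ∧
      (da ∈ X ↔ da ∉ Y) ∧ (bc ∈ X ↔ bc ∉ Y) := by
    by_cases hX : ∃ X ∈ D, da ∈ X ∧ bc ∈ X
    · obtain ⟨X, hX, h1, h2⟩ := hX
      obtain ⟨D', rfl⟩ := Multiset.exists_cons_of_mem hX
      refine ⟨X, ∅, D', ?_, ?_, by simp [h1], by simp [h2]⟩
      · intro T hT
        simp only [Multiset.mem_cons] at hT hD
        rcases hT with rfl | rfl | hT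
        · exact hD _ (Or.inl rfl)
        · exact ⟨by simp, ev_empty M⟩
        · exact hD _ (Or.inr hT)
      · intro e he
        have := hcov e he
        simpa using this
    · push Not at hX
      obtain ⟨X, D', rfl, hXda⟩ := cov_pos (D := D) (e := da) (by split_ifs at hda <;> omega)
      have hXbc := hX X (Multiset.mem_cons_self _ _) hXda
      rw [cov_cons, if_neg hXbc] at hbc
      obtain ⟨Y, D2, rfl, hYbc⟩ := cov_pos (D := D') (e := bc) (by split_ifs at hbc <;> omega)
      refine ⟨X, Y, D2, hD, hcov, ?_, by simp [hXbc, hYbc]⟩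
      simp only [hXda, true_iff]
      intro hY
      exact hX Y (by simp) hY hYbc
  clear hD hcov hda hbc D
  obtain ⟨X, Y, D2, hD, hcov, h1, h2⟩ := hsel
  have hXY : ∀ T ∈ X ::ₘ Y ::ₘ D2, ab ∉ T ∧ cd ∉ T := by
    intro T hT
    exact ⟨fun h => ((hD T hT).1 h).2 (by simp), fun h => ((hD T hT).1 h).2 (by simp)⟩
  have hX := hXY X (by simp)
  have hY := hXY Y (by simp)
  have hD0 : cov D2 ab = 0 ∧ cov D2 cd = 0 := by
    constructor <;> rw [cov_zero_iff] <;> intro T hT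
    · exact (hXY T (by simp [hT])).1
    · exact (hXY T (by simp [hT])).2
  have hsE : ∀ T ∈ X ::ₘ Y ::ₘ D2, T ⊆ M.E := fun T hT f hf => ((hD T hT).1 hf).1
  apply h.bad
  refine ⟨(X ∆ {ab, bc, cd, da}) ::ₘ (Y ∆ {ab, bc, cd, da}) ::ₘ D2, ?_, ?_⟩
  · intro T hT
    simp only [Multiset.mem_cons] at hT hD hsE
    rcases hT with rfl | rfl | hT
    · exact ⟨symmDiff_sub (hsE _ (by simp)) q.subQ, (hD _ (by simp)).2.symmDiff q.evQ⟩
    · exact ⟨symmDiff_sub (hsE _ (by simp)) q.subQ, (hD _ (by simp)).2.symmDiff q.evQ⟩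
    · exact ⟨hsE _ (by simp [hT]), (hD _ (by simp [hT])).2⟩
  · intro e he
    by_cases e1 : e = ab
    · subst e1; simp [Set.mem_symmDiff, hX.1, hY.1, hD0.1, hab]
    by_cases e2 : e = cd
    · subst e2; simp [Set.mem_symmDiff, hX.2, hY.2, hD0.2, hcd]
    have h3 := hcov e ⟨he, by simp [e1, e2]⟩
    simp only [cov_cons] at h3 ⊢
    by_cases e3 : e = da
    · subst e3
      by_cases h4 : e ∈ Y <;> simp [Set.mem_symmDiff, h1, h4] at h3 ⊢ <;> omega
    by_cases e4 : e = bc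
    · subst e4
      by_cases h4 : e ∈ Y <;> simp [Set.mem_symmDiff, h2, h4] at h3 ⊢ <;> omega
    · simpa [Set.mem_symmDiff, e1, e2, e3, e4] using h3

/-- Case III -/
lemma Quad.case_three (q : Quad M a b c d ab bc cd da pa pb pc pd) (h : Mini M C) :
    ¬ (ab ∈ C ∧ bc ∈ C ∧ cd ∈ C ∧ da ∉ C) := by
  rintro ⟨hab, hbc, hcd, hda⟩
  obtain ⟨hb, hE⟩ := q.del2 h
  have hm := q.memE
  have nd := q.nd
  simp only [List.nodup_cons, List.mem_cons, List.not_mem_nil, or_false, not_or] at nd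
  set Q : Set F := {ab, bc, cd, da} with hQ
  have mQ : ∀ f, f ∈ Q ↔ f = ab ∨ f = bc ∨ f = cd ∨ f = da := fun f => Iff.rfl
  have hC' : (M.del {ab, cd}).Circ (C ∆ Q) := by
    refine ⟨?_, h.circ.2.1.symmDiff q.evQ, ?_⟩
    · intro f hf
      refine ⟨symmDiff_sub h.circ.1 q.subQ hf, ?_⟩
      rintro (rfl | rfl) <;> simp [Set.mem_symmDiff, mQ] at hf <;> tauto
    · intro T hT hTe
      have hTe' : M.Ev T := hTe
      have hT' : ∀ f ∈ T, (f ∈ C ∧ f ∉ Q) ∨ (f ∈ Q ∧ f ∉ C) := fun f hf => hT hf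
      by_cases hdaT : da ∈ T
      · right
        have h1 : T ∆ Q ⊆ C := by
          rintro f (⟨h1, h2⟩ | ⟨h1, h2⟩)
          · have := hT' f h1; tauto
          · rw [mQ] at h1
            rcases h1 with rfl | rfl | rfl | rfl <;> tauto
        rcases h.circ.2.2 _ h1 (hTe'.symmDiff q.evQ) with h2 | h2
        · exfalso
          have h3 : ab ∈ T ∆ Q := by
            right
            refine ⟨by simp [mQ], fun h4 => ?_⟩
            have := hT' _ h4
            simp only [mQ, true_or, not_true_eq_false, and_false, true_and, false_or] at this
            exact this hab
          rw [h2] at h3; exact h3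
        · rw [← h2, symmDiff_assoc, symmDiff_self]; exact (symmDiff_bot T).symm
      · left
        have h1 : T ⊆ C := by
          intro f hf
          have h3 := hT' f hf
          rw [mQ] at h3
          rcases h3 with h3 | ⟨rfl | rfl | rfl | rfl, h4⟩ <;> tauto
        rcases h.circ.2.2 _ h1 hTe' with h2 | h2
        · exact h2
        · exfalso
          rw [← h2] at hab
          have := hT' _ hab
          rw [mQ] at this
          rw [h2] at hab
          simp at this
          exact this hab
  obtain ⟨D, hD, hcov⟩ := h.small' _ (h.lpl.del _) hb hE _ hC'
  have cda := hcov da ⟨hm.2.2.2, by simp; grind⟩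
  have cbc := hcov bc ⟨hm.2.1, by simp; grind⟩
  simp only [Set.mem_symmDiff, mQ, hda, hbc] at cda cbc
  simp at cda cbc
  have hsel : ∃ Y D', D = Y ::ₘ D' ∧ bc ∈ Y ∧ da ∉ Y := by
    obtain ⟨Y1, D1, rfl, hY1⟩ := cov_pos (D := D) (e := bc) (by omega)
    by_cases h1 : da ∈ Y1
    · simp only [cov_cons, hY1, h1, if_true] at cbc cda
      obtain ⟨Y2, D2, rfl, hY2⟩ := cov_pos (D := D1) (e := bc) (by omega)
      refine ⟨Y2, Y1 ::ₘ D2, Multiset.cons_swap _ _ _, hY2, ?_⟩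
      have : cov (Y2 ::ₘ D2) da = 0 := by omega
      exact cov_zero_iff.1 this Y2 (by simp)
    · exact ⟨Y1, D1, rfl, hY1, h1⟩
  obtain ⟨Y, D', rfl, hYbc, hYda⟩ := hsel
  have hXY : ∀ T ∈ Y ::ₘ D', ab ∉ T ∧ cd ∉ T := by
    intro T hT
    exact ⟨fun h => ((hD T hT).1 h).2 (by simp), fun h => ((hD T hT).1 h).2 (by simp)⟩
  have hY := hXY Y (by simp)
  have hD0 : cov D' ab = 0 ∧ cov D' cd = 0 := by
    constructor <;> rw [cov_zero_iff] <;> intro T hT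
    · exact (hXY T (by simp [hT])).1
    · exact (hXY T (by simp [hT])).2
  have hsE : ∀ T ∈ Y ::ₘ D', T ⊆ M.E := fun T hT f hf => ((hD T hT).1 hf).1
  apply h.bad
  refine ⟨(Y ∆ Q) ::ₘ D', ?_, ?_⟩
  · intro T hT
    simp only [Multiset.mem_cons] at hT hD hsE
    rcases hT with rfl | hT
    · exact ⟨symmDiff_sub (hsE _ (by simp)) q.subQ, Ev.symmDiff (M := M) (hD Y (by simp)).2 q.evQ⟩
    · exact ⟨hsE _ (by simp [hT]), (hD _ (by simp [hT])).2⟩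
  · intro e he
    by_cases e1 : e = ab
    · subst e1; simp [Set.mem_symmDiff, mQ, hY.1, hD0.1, hab]
    by_cases e2 : e = cd
    · subst e2; simp [Set.mem_symmDiff, mQ, hY.2, hD0.2, hcd]
    have h3 := hcov e ⟨he, by simp [e1, e2]⟩
    simp only [cov_cons] at h3 ⊢ cda cbc
    by_cases e3 : e = da
    · subst e3
      simp [Set.mem_symmDiff, mQ, hYda, hda] at cda ⊢; omega
    by_cases e4 : e = bc
    · subst e4
      simp [Set.mem_symmDiff, mQ, hYbc, hbc] at cbc ⊢; omega
    · simpa [Set.mem_symmDiff, mQ, e1, e2, e3, e4] using h3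

end MG

namespace MG
variable {W F : Type} [Fintype W] [Fintype F]
variable {M : MG W F} {C : Set F} {a b c d : W} {ab bc cd da pa pb pc pd : F}

lemma exists_circ (M : MG W F) (n : ℕ) : ∀ T : Set F, T.ncard ≤ n → T ⊆ M.E → M.Ev T → ∀ e ∈ T,
    ∃ C', M.Circ C' ∧ C' ⊆ T ∧ e ∈ C' := by
  induction n with
  | zero =>
    intro T hT _ _ e he
    have : T = ∅ := (Set.ncard_eq_zero (Set.toFinite _)).1 (by omega)
    rw [this] at he; exact he.elim
  | succ n ih =>
    intro T hT hTE hTe e he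
    by_cases hcirc : M.Circ T
    · exact ⟨T, hcirc, subset_rfl, he⟩
    · simp only [Circ, hTE, hTe, true_and] at hcirc
      push Not at hcirc
      obtain ⟨S, hST, hS, hS1, hS2⟩ := hcirc
      have hlt : S ⊂ T := hST.ssubset_of_ne hS2
      by_cases heS : e ∈ S
      · have := Set.ncard_lt_ncard hlt
        obtain ⟨C', h1, h2, h3⟩ := ih S (by omega) (hST.trans hTE) hS e heS
        exact ⟨C', h1, h2.trans hST, h3⟩
      · have hlt2 : T \ S ⊂ T := by
          refine ⟨Set.sdiff_subset, fun h => ?_⟩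
          obtain ⟨f, hf⟩ := hS1
          exact (h (hST hf)).2 hf
        have := Set.ncard_lt_ncard hlt2
        obtain ⟨C', h1, h2, h3⟩ := ih (T \ S) (by omega) (Set.sdiff_subset.trans hTE) (hTe.sdiff hS hST) e ⟨he, heS⟩
        exact ⟨C', h1, h2.trans Set.sdiff_subset, h3⟩

lemma Quad.all_aux (q : Quad M a b c d ab bc cd da pa pb pc pd) (h : Mini M C)
    (hCQ : C = {ab, bc, cd, da}) {E0 : Set F}
    (hE0 : ∀ e ∈ E0, e ∈ M.E ∧ e ∉ M.cr {b} ∧ e ∉ M.cr {c} ∧ e ∉ M.cr {d}) {z : W}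
    (hz : M.Rch E0 a z) : M.ends pb ≠ s(b, z) := by
  intro hpb
  have hm := q.memE
  have nd := q.nd
  simp only [List.nodup_cons, List.mem_cons, List.not_mem_nil, or_false, not_or] at nd
  obtain ⟨P, hP, hpar⟩ := hz.join
  have mb : ∀ f, (f = bc ∨ f = ab ∨ f = pb) → f ∈ M.cut {b} := by
    intro f hf; rw [q.cutb]; exact hf
  have mc : ∀ f, (f = cd ∨ f = bc ∨ f = pc) → f ∈ M.cut {c} := by
    intro f hf; rw [q.cutc]; exact hf
  have md : ∀ f, (f = da ∨ f = cd ∨ f = pd) → f ∈ M.cut {d} := by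
    intro f hf; rw [q.cutd]; exact hf
  have ma : ∀ f, (f = ab ∨ f = da ∨ f = pa) → f ∈ M.cut {a} := by
    intro f hf; rw [q.cuta]; exact hf
  have nP : ∀ f ∈ P, f ≠ ab ∧ f ≠ bc ∧ f ≠ cd ∧ f ≠ da ∧ f ≠ pb ∧ f ≠ pc ∧ f ≠ pd := by
    intro f hf
    have h1 := hE0 f (hP hf)
    refine ⟨?_, ?_, ?_, ?_, ?_, ?_, ?_⟩ <;> rintro rfl
    · exact h1.2.1 (mb _ (by simp)).2
    · exact h1.2.1 (mb _ (by simp)).2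
    · exact h1.2.2.1 (mc _ (by simp)).2
    · exact h1.2.2.2 (md _ (by simp)).2
    · exact h1.2.1 (mb _ (by simp)).2
    · exact h1.2.2.1 (mc _ (by simp)).2
    · exact h1.2.2.2 (md _ (by simp)).2
  set T : Set F := (((P ∆ {pb}) ∆ {bc}) ∆ {cd}) ∆ {da} with hT
  have hTe : M.Ev T := by
    rw [ev_iff]
    intro v
    simp only [hT, par_symmDiff, hpar, par_ends' hpb, par_ends' q.ebc, par_ends' q.ecd, par_ends' q.eda]
    generalize (if v = a then (1 : ZMod 2) else 0) = x
    generalize (if v = b then (1 : ZMod 2) else 0) = y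
    generalize (if v = c then (1 : ZMod 2) else 0) = u
    generalize (if v = d then (1 : ZMod 2) else 0) = w
    generalize (if v = z then (1 : ZMod 2) else 0) = t
    revert x y u w t; decide
  have hsing : ∀ f, f ∈ M.E → ({f} : Set F) ⊆ M.E := by rintro f hf g rfl; exact hf
  have hTE : T ⊆ M.E := by
    refine symmDiff_sub (symmDiff_sub (symmDiff_sub (symmDiff_sub ?_ (hsing _ (mb pb (by simp)).1)) (hsing _ hm.2.1))
      (hsing _ hm.2.2.1)) (hsing _ hm.2.2.2)
    exact fun f hf => (hE0 f (hP hf)).1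
  have mT : ∀ f, f ∉ P → (f ∈ T → f = pb ∨ f = bc ∨ f = cd ∨ f = da) := by
    intro f hf hfT
    simp only [hT, Set.mem_symmDiff, Set.mem_singleton_iff] at hfT
    tauto
  have hcdT : cd ∈ T := by
    have := fun h => (nP cd h).2.2.1
    simp only [hT, Set.mem_symmDiff, Set.mem_singleton_iff]
    grind
  obtain ⟨C', hC', hC'T, hcd'⟩ := exists_circ M _ T le_rfl hTE hTe cd hcdT
  have habC' : ab ∉ C' := by
    intro h1
    have := mT ab (fun h => (nP ab h).1 rfl) (hC'T h1)
    grind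
  have hpc : pc ∉ C' := by
    intro h1
    have := mT pc (fun h => (nP pc h).2.2.2.2.2.1 rfl) (hC'T h1)
    grind
  have hpd : pd ∉ C' := by
    intro h1
    have := mT pd (fun h => (nP pd h).2.2.2.2.2.2 rfl) (hC'T h1)
    grind
  have ec := q.rot.rot.even_a hC'.1 hC'.2.1
  have ed := q.rot.rot.rot.even_a hC'.1 hC'.2.1
  have hbc' : bc ∈ C' := by tauto
  have hda' : da ∈ C' := by tauto
  have heq := h.stable hC' (by
    rintro v ⟨e, heC, hev⟩
    have h1 : v = a ∨ v = b ∨ v = c ∨ v = d := by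
      by_contra hcon
      push Not at hcon
      rw [hCQ] at heC
      rcases heC with rfl | rfl | rfl | rfl
      · rw [mem_cr_ends q.eab] at hev; simp only [Set.mem_singleton_iff] at hev; grind
      · rw [mem_cr_ends q.ebc] at hev; simp only [Set.mem_singleton_iff] at hev; grind
      · rw [mem_cr_ends q.ecd] at hev; simp only [Set.mem_singleton_iff] at hev; grind
      · rw [mem_cr_ends q.eda] at hev; simp only [Set.mem_singleton_iff] at hev; grind
    rcases h1 with rfl | rfl | rfl | rfl
    · exact ⟨da, hda', (ma da (by simp)).2⟩
    · exact ⟨bc, hbc', (mb bc (by simp)).2⟩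
    · exact ⟨bc, hbc', (mc bc (by simp)).2⟩
    · exact ⟨da, hda', (md da (by simp)).2⟩)
  rw [heq, hCQ] at habC'
  exact habC' (by simp)

/-- Case II -/
lemma Quad.case_all (q : Quad M a b c d ab bc cd da pa pb pc pd) (h : Mini M C) :
    ¬ (ab ∈ C ∧ bc ∈ C ∧ cd ∈ C ∧ da ∈ C) := by
  rintro ⟨h1, h2, h3, h4⟩
  have nd := q.nd
  simp only [List.nodup_cons, List.mem_cons, List.not_mem_nil, or_false, not_or] at nd
  have hCQ : C = {ab, bc, cd, da} := by
    rcases h.circ.2.2 {ab, bc, cd, da} (by rintro f (rfl | rfl | rfl | rfl) <;> assumption) q.evQ with h5 | h5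
    · have : ab ∈ ({ab, bc, cd, da} : Set F) := by simp
      rw [h5] at this; exact this.elim
    · exact h5.symm
  set E0 : Set F := {e ∈ M.E | e ∉ M.cr {b} ∧ e ∉ M.cr {c} ∧ e ∉ M.cr {d}} with hE0
  set A : Set W := {y | M.Rch E0 a y} with hA
  have haA : a ∈ A := Relation.ReflTransGen.refl
  have hnot : ∀ x, x ≠ a → (∀ e ∈ E0, e ∉ M.cr {x}) → x ∉ A := by
    intro x hx hx' hxA
    rcases Relation.ReflTransGen.cases_tail hxA with h5 | ⟨y, _, e, he, hye⟩
    · exact hx h5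
    · have h6 := hx' e he
      have hl := h.lpl e he.1
      rw [mem_cr_single hl, ends, Sym2.mem_iff] at h6
      rcases hye with ⟨h7, h8⟩ | ⟨h7, h8⟩
      · exact h6 (Or.inr h8.symm)
      · exact h6 (Or.inl h7.symm)
  have hbA := hnot b q.vab.symm (fun e he => he.2.1)
  have hcA := hnot c q.vac.symm (fun e he => he.2.2.1)
  have hdA := hnot d q.vad.symm (fun e he => he.2.2.2)
  have hcut : M.cut A ⊆ {ab, da, pc} := by
    intro e he
    have h5 : e ∉ E0 := fun h => Rch.not_cr h he.2
    have h6 : e ∈ M.cr {b} ∨ e ∈ M.cr {c} ∨ e ∈ M.cr {d} := by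
      by_contra hcon
      push Not at hcon
      exact h5 ⟨he.1, hcon⟩
    have hbc' : e ≠ bc := by
      rintro rfl
      have := he.2
      rw [mem_cr_ends q.ebc] at this; tauto
    have hcd' : e ≠ cd := by
      rintro rfl
      have := he.2
      rw [mem_cr_ends q.ecd] at this; tauto
    simp only [Set.mem_insert_iff, Set.mem_singleton_iff]
    rcases h6 with h6 | h6 | h6
    · have h7 : e ∈ M.cut {b} := ⟨he.1, h6⟩
      have h8 := h7
      rw [q.cutb] at h7
      rcases h7 with h7 | h7 | h7
      · tauto
      · tauto
      · exfalso
        obtain ⟨z, _, hz⟩ := exists_other h.lpl h8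
        have h9 := he.2
        rw [mem_cr_ends hz] at h9
        have hzA : z ∈ A := by tauto
        subst h7
        exact q.all_aux h hCQ (E0 := E0) (fun e he => ⟨he.1, he.2⟩) hzA hz
    · have h7 : e ∈ M.cut {c} := ⟨he.1, h6⟩
      rw [q.cutc] at h7
      rcases h7 with h7 | h7 | h7 <;> tauto
    · have h7 : e ∈ M.cut {d} := ⟨he.1, h6⟩
      have h8 := h7
      rw [q.cutd] at h7
      rcases h7 with h7 | h7 | h7
      · tauto
      · tauto
      · exfalso
        obtain ⟨z, _, hz⟩ := exists_other h.lpl h8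
        have h9 := he.2
        rw [mem_cr_ends hz] at h9
        have hzA : z ∈ A := by tauto
        subst h7
        refine q.refl.all_aux h ?_ (E0 := E0) (fun e he => ⟨he.1, he.2.2.2, he.2.2.1, he.2.1⟩) hzA hz
        rw [hCQ]; ext f; simp only [Set.mem_insert_iff, Set.mem_singleton_iff]; tauto
  have hc3 : (M.cut A).ncard ≤ 3 := by
    refine (Set.ncard_le_ncard hcut).trans ?_
    have e1 := Set.ncard_insert_le ab ({da, pc} : Set F)
    have e2 := Set.ncard_insert_le da ({pc} : Set F)
    rw [Set.ncard_singleton] at e2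
    omega
  obtain ⟨x, hx | hx⟩ := h.small_cut ⟨a, haA⟩ ⟨b, hbA⟩ hc3
  · have hax : a = x := by rw [hx] at haA; exact haA
    have hpa : pa ∈ M.cut A := by
      rw [hx, ← hax, q.cuta]; simp
    have := hcut hpa
    simp only [Set.mem_insert_iff, Set.mem_singleton_iff] at this
    grind
  · have h5 : b = x := by
      have : b ∈ Aᶜ := hbA
      rw [hx] at this; exact this
    have h6 : c = x := by
      have : c ∈ Aᶜ := hcA
      rw [hx] at this; exact this
    exact q.vbc (h5.trans h6.symm)

end MG

namespace MG
variable {W F : Type} [Fintype W] [Fintype F]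
variable {M : MG W F} {C : Set F} {a b c d : W} {ab bc cd da pa pb pc pd : F}

set_option maxHeartbeats 4000000 in
/-- Case IV -/
lemma Quad.case_adj (q : Quad M a b c d ab bc cd da pa pb pc pd) (h : Mini M C) :
    ¬ (ab ∈ C ∧ bc ∈ C ∧ cd ∉ C ∧ da ∉ C) := by
  rintro ⟨hab, hbc, hcd, hda⟩
  obtain ⟨hb, hE⟩ := q.del1 h
  have hm := q.memE
  have nd := q.nd
  simp only [List.nodup_cons, List.mem_cons, List.not_mem_nil, or_false, not_or] at nd
  have hpaE : pa ∈ M.E := by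
    have : pa ∈ M.cut {a} := by rw [q.cuta]; simp
    exact this.1
  have hpbE : pb ∈ M.E := by
    have : pb ∈ M.cut {b} := by rw [q.cutb]; simp
    exact this.1
  have hpaC : pa ∈ C := by
    have := q.even_a h.circ.1 h.circ.2.1; tauto
  have hpbC : pb ∉ C := by
    have := q.rot.even_a h.circ.1 h.circ.2.1; tauto
  obtain ⟨D, hD, hcov⟩ := h.small' _ (h.lpl.del _) hb hE C (circ_del h.circ (by
    rintro e he rfl; tauto))
  have hsE : ∀ T ∈ D, T ⊆ M.E := fun T hT f hf => ((hD T hT).1 hf).1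
  have hev : ∀ T ∈ D, M.Ev T := fun T hT => (hD T hT).2
  have hncd : ∀ T ∈ D, cd ∉ T := fun T hT hf => ((hD T hT).1 hf).2 rfl
  have hcov' : ∀ e ∈ M.E, e ≠ cd → cov D e + (if e ∈ C then 1 else 0) = 2 :=
    fun e he hne => hcov e ⟨he, hne⟩
  clear hD hcov
  have cab := hcov' ab hm.1 (by grind)
  have cbc := hcov' bc hm.2.1 (by grind)
  have cda := hcov' da hm.2.2.2 (by grind)
  have cpa := hcov' pa hpaE (by grind)
  have cpb := hcov' pb hpbE (by grind)
  rw [if_pos hab] at cab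
  rw [if_pos hbc] at cbc
  rw [if_neg hda] at cda
  rw [if_pos hpaC] at cpa
  rw [if_neg hpbC] at cpb
  obtain ⟨X2, D', rfl, hX2ab⟩ := cov_pos (D := D) (e := ab) (by omega)
  simp only [cov_cons] at cab cbc cda cpa cpb
  rw [if_pos hX2ab] at cab
  have zab : ∀ T ∈ D', ab ∉ T := cov_zero_iff.1 (by omega)
  have ea : ∀ T ∈ X2 ::ₘ D', _ := fun T hT => q.even_a (hsE T hT) (hev T hT)
  have eb : ∀ T ∈ X2 ::ₘ D', _ := fun T hT => q.rot.even_a (hsE T hT) (hev T hT)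
  have hX2pa : pa ∉ X2 := by
    intro h1
    have h2 := ea X2 (by simp)
    have h3 : da ∉ X2 := by tauto
    rw [if_neg h3] at cda
    rw [if_pos h1] at cpa
    obtain ⟨X, D3, rfl, hX⟩ := cov_pos (D := D') (e := da) (by omega)
    have h4 := ea X (by simp)
    have h5 := zab X (by simp)
    have h6 : pa ∈ X := by tauto
    simp only [cov_cons, if_pos h6] at cpa
    omega
  have hX2da : da ∈ X2 := by
    have h2 := ea X2 (by simp); tauto
  have hX2bc : bc ∉ X2 := by
    intro h1
    have h2 := eb X2 (by simp)
    have h3 : pb ∉ X2 := by tauto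
    rw [if_neg h3] at cpb
    rw [if_pos h1] at cbc
    obtain ⟨X, D3, rfl, hX⟩ := cov_pos (D := D') (e := pb) (by omega)
    have h4 := eb X (by simp)
    have h5 := zab X (by simp)
    have h6 : bc ∈ X := by tauto
    simp only [cov_cons, if_pos h6] at cbc
    omega
  have hX2cd : cd ∉ X2 := hncd X2 (by simp)
  rw [if_pos hX2da] at cda
  rw [if_neg hX2bc] at cbc
  obtain ⟨X1, D2, rfl, hX1da⟩ := cov_pos (D := D') (e := da) (by omega)
  simp only [cov_cons, if_pos hX1da] at cda
  have hX1ab := zab X1 (by simp)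
  have hX1cd := hncd X1 (by simp)
  simp only [cov_cons] at cbc
  have zD2da : cov D2 da = 0 := by omega
  have zD2ab : cov D2 ab = 0 := by rw [cov_zero_iff]; intro T hT; exact zab T (by simp [hT])
  have zD2cd : cov D2 cd = 0 := by rw [cov_zero_iff]; intro T hT; exact hncd T (by simp [hT])
  have hsing : ∀ f, f ∈ M.E → ({f} : Set F) ⊆ M.E := by rintro f hf g rfl; exact hf
  simp only [Multiset.mem_cons] at hsE hev
  by_cases hbcX1 : bc ∈ X1
  · rw [if_pos hbcX1] at cbc
    have zD2bc : cov D2 bc = 0 := by omega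
    set T : Set F := (X1 ∆ {da}) ∆ {bc} with hT
    have hTE : T ⊆ M.E := symmDiff_sub (symmDiff_sub (hsE _ (by simp)) (hsing _ hm.2.2.2)) (hsing _ hm.2.1)
    have hpT : ∀ v, M.par T {v} = (if v = a then 1 else 0) + (if v = b then 1 else 0) +
        (if v = c then 1 else 0) + (if v = d then 1 else 0) := by
      intro v
      rw [hT, par_symmDiff, par_symmDiff, (ev_iff M X1).1 (hev _ (by simp)) v, par_ends' q.eda, par_ends' q.ebc]
      ring
    have mT : ∀ f, f ∈ T ↔ f ∈ X1 ∧ f ≠ da ∧ f ≠ bc := by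
      intro f
      simp only [hT, Set.mem_symmDiff, Set.mem_singleton_iff]
      grind
    obtain ⟨y, hya, hy, hr⟩ := Rch.exists_odd (M := M) (T := T) (x := a) (by
      rw [hpT]; simp [q.vab, q.vac, q.vad])
    have hy' : y = b ∨ y = c ∨ y = d := by
      by_contra hcon
      push Not at hcon
      rw [hpT] at hy
      simp [hya, hcon] at hy
    obtain ⟨P, hP, hpP⟩ := hr.join
    have hPE : P ⊆ M.E := hP.trans hTE
    have mP : ∀ f ∈ P, f ≠ ab ∧ f ≠ bc ∧ f ≠ cd ∧ f ≠ da ∧ f ∈ X1 := by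
      intro f hf
      have := (mT f).1 (hP hf)
      refine ⟨?_, this.2.2, ?_, this.2.1, this.1⟩
      · rintro rfl; tauto
      · rintro rfl; tauto
    have hPab : ab ∉ P := fun h => (mP _ h).1 rfl
    have hPbc : bc ∉ P := fun h => (mP _ h).2.1 rfl
    have hPcd : cd ∉ P := fun h => (mP _ h).2.2.1 rfl
    have hPda : da ∉ P := fun h => (mP _ h).2.2.2.1 rfl
    have hTP : T \ P = T ∆ P := sdiff_eq_symmDiff hP
    have hTPE : T \ P ⊆ M.E := Set.sdiff_subset.trans hTE
    -- finisher
    have fin : ∀ A B X : Set F, A ⊆ M.E → B ⊆ M.E → X ⊆ M.E → M.Ev A → M.Ev B → M.Ev X →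
        (∀ f, f ≠ ab → f ≠ bc → f ≠ cd → f ≠ da →
          (if f ∈ A then 1 else 0) + (if f ∈ B then 1 else 0) + (if f ∈ X then 1 else 0)
          = (if f ∈ X1 then 1 else 0) + (if f ∈ X2 then 1 else 0)) →
        ((if ab ∈ A then 1 else 0) + (if ab ∈ B then 1 else 0) + (if ab ∈ X then 1 else 0) = 1) →
        ((if bc ∈ A then 1 else 0) + (if bc ∈ B then 1 else 0) + (if bc ∈ X then 1 else 0) = 1) →
        ((if cd ∈ A then 1 else 0) + (if cd ∈ B then 1 else 0) + (if cd ∈ X then 1 else 0) = 2) →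
        ((if da ∈ A then 1 else 0) + (if da ∈ B then 1 else 0) + (if da ∈ X then 1 else 0) = 2) → False := by
      intro A B X hA hB hX hA' hB' hX' hf f1 f2 f3 f4
      apply h.bad
      refine ⟨A ::ₘ B ::ₘ X ::ₘ D2, ?_, ?_⟩
      · intro S hS
        simp only [Multiset.mem_cons] at hS
        rcases hS with rfl | rfl | rfl | hS
        · exact ⟨hA, hA'⟩
        · exact ⟨hB, hB'⟩
        · exact ⟨hX, hX'⟩
        · exact ⟨hsE S (by simp [hS]), hev S (by simp [hS])⟩
      · intro e he
        simp only [cov_cons]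
        by_cases e1 : e = ab
        · subst e1; rw [zD2ab, if_pos hab]; omega
        by_cases e2 : e = bc
        · subst e2; rw [zD2bc, if_pos hbc]; omega
        by_cases e3 : e = cd
        · subst e3; rw [zD2cd, if_neg hcd]; omega
        by_cases e4 : e = da
        · subst e4; rw [zD2da, if_neg hda]; omega
        have h1 := hf e e1 e2 e3 e4
        have h2 := hcov' e he e3
        simp only [cov_cons] at h2
        omega
    have hgen : ∀ f, f ≠ ab → f ≠ bc → f ≠ cd → f ≠ da →
          (if f ∈ P then 1 else 0) + (if f ∈ T \ P then 1 else 0) = (if f ∈ X1 then 1 else 0) := by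
      intro f f1 f2 f3 f4
      have h1 := mT f
      have h2 := @hP f
      by_cases hf : f ∈ P
      · have h3 := h1.1 (h2 hf)
        simp [hf, h3]
      · by_cases hf' : f ∈ T
        · simp [hf, hf', (h1.1 hf').1]
        · have : f ∉ X1 := by tauto
          simp [hf, hf', this]
    have hTPab : ab ∉ T \ P := fun h => hX1ab ((mT _).1 h.1).1
    have hTPcd : cd ∉ T \ P := fun h => hX1cd ((mT _).1 h.1).1
    have hTPbc : bc ∉ T \ P := fun h => ((mT _).1 h.1).2.2 rfl
    have hTPda : da ∉ T \ P := fun h => ((mT _).1 h.1).2.1 rfl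
    have hpTP : ∀ v, M.par (T \ P) {v} = M.par T {v} + M.par P {v} := by
      intro v; rw [hTP, par_symmDiff]
    obtain ⟨R, hTPE, hgen, hTPab, hTPcd, hTPbc, hTPda, hpTP⟩ : ∃ R : Set F, R ⊆ M.E ∧
        (∀ f, f ≠ ab → f ≠ bc → f ≠ cd → f ≠ da →
          (if f ∈ P then 1 else 0) + (if f ∈ R then 1 else 0) = (if f ∈ X1 then 1 else 0)) ∧
        ab ∉ R ∧ cd ∉ R ∧ bc ∉ R ∧ da ∉ R ∧ ∀ v, M.par R {v} = M.par T {v} + M.par P {v} :=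
      ⟨T \ P, hTPE, by convert hgen, hTPab, hTPcd, hTPbc, hTPda, hpTP⟩
    clear hTP
    have nab : ab ≠ bc ∧ ab ≠ cd ∧ ab ≠ da ∧ bc ≠ ab ∧ bc ≠ cd ∧ bc ≠ da ∧ cd ≠ ab ∧ cd ≠ bc ∧ cd ≠ da ∧
      da ≠ ab ∧ da ≠ bc ∧ da ≠ cd := by grind
    have sE := fun {S T : Set F} (h1 : S ⊆ M.E) (h2 : T ⊆ M.E) => symmDiff_sub h1 h2
    rcases hy' with rfl | rfl | rfl
    · apply fin (((P ∆ {da}) ∆ {cd}) ∆ {bc}) (R ∆ {cd}) X2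
        (sE (sE (sE hPE (hsing _ hm.2.2.2)) (hsing _ hm.2.2.1)) (hsing _ hm.2.1))
        (sE hTPE (hsing _ hm.2.2.1)) (hsE _ (by simp)) ?_ ?_ (hev _ (by simp))
      · intro f f1 f2 f3 f4
        have := hgen f f1 f2 f3 f4
        simp only [Set.mem_symmDiff, Set.mem_singleton_iff, f1, f2, f3, f4, not_false_eq_true, and_true, false_and, or_false]
        omega
      · simp [Set.mem_symmDiff, nab, hPab, hPbc, hPcd, hPda, hTPab, hTPbc, hTPcd, hTPda, hX2ab, hX2bc, hX2cd, hX2da]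
      · simp [Set.mem_symmDiff, nab, hPab, hPbc, hPcd, hPda, hTPab, hTPbc, hTPcd, hTPda, hX2ab, hX2bc, hX2cd, hX2da]
      · simp [Set.mem_symmDiff, nab, hPab, hPbc, hPcd, hPda, hTPab, hTPbc, hTPcd, hTPda, hX2ab, hX2bc, hX2cd, hX2da]
      · simp [Set.mem_symmDiff, nab, hPab, hPbc, hPcd, hPda, hTPab, hTPbc, hTPcd, hTPda, hX2ab, hX2bc, hX2cd, hX2da]
      · rw [ev_iff]; intro v
        simp only [par_symmDiff, hpP, par_ends' q.ebc, par_ends' q.ecd, par_ends' q.eda]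
        generalize (if v = a then (1 : ZMod 2) else 0) = x
        generalize (if v = y then (1 : ZMod 2) else 0) = y
        generalize (if v = c then (1 : ZMod 2) else 0) = z
        generalize (if v = d then (1 : ZMod 2) else 0) = w
        revert x y z w; decide
      · rw [ev_iff]; intro v
        simp only [par_symmDiff, hpTP, hpT, hpP, par_ends' q.ebc, par_ends' q.ecd, par_ends' q.eda]
        generalize (if v = a then (1 : ZMod 2) else 0) = x
        generalize (if v = y then (1 : ZMod 2) else 0) = y
        generalize (if v = c then (1 : ZMod 2) else 0) = z
        generalize (if v = d then (1 : ZMod 2) else 0) = w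
        revert x y z w; decide
    · apply fin ((P ∆ {da}) ∆ {cd}) ((R ∆ {bc}) ∆ {cd}) X2
        (sE (sE hPE (hsing _ hm.2.2.2)) (hsing _ hm.2.2.1))
        (sE (sE hTPE (hsing _ hm.2.1)) (hsing _ hm.2.2.1)) (hsE _ (by simp)) ?_ ?_ (hev _ (by simp))
      · intro f f1 f2 f3 f4
        have := hgen f f1 f2 f3 f4
        simp only [Set.mem_symmDiff, Set.mem_singleton_iff, f1, f2, f3, f4, not_false_eq_true, and_true, false_and, or_false]
        omega
      · simp [Set.mem_symmDiff, nab, hPab, hPbc, hPcd, hPda, hTPab, hTPbc, hTPcd, hTPda, hX2ab, hX2bc, hX2cd, hX2da]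
      · simp [Set.mem_symmDiff, nab, hPab, hPbc, hPcd, hPda, hTPab, hTPbc, hTPcd, hTPda, hX2ab, hX2bc, hX2cd, hX2da]
      · simp [Set.mem_symmDiff, nab, hPab, hPbc, hPcd, hPda, hTPab, hTPbc, hTPcd, hTPda, hX2ab, hX2bc, hX2cd, hX2da]
      · simp [Set.mem_symmDiff, nab, hPab, hPbc, hPcd, hPda, hTPab, hTPbc, hTPcd, hTPda, hX2ab, hX2bc, hX2cd, hX2da]
      · rw [ev_iff]; intro v
        simp only [par_symmDiff, hpP, par_ends' q.ebc, par_ends' q.ecd, par_ends' q.eda]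
        generalize (if v = a then (1 : ZMod 2) else 0) = x
        generalize (if v = b then (1 : ZMod 2) else 0) = u
        generalize (if v = y then (1 : ZMod 2) else 0) = z
        generalize (if v = d then (1 : ZMod 2) else 0) = w
        revert x u z w; decide
      · rw [ev_iff]; intro v
        simp only [par_symmDiff, hpTP, hpT, hpP, par_ends' q.ebc, par_ends' q.ecd, par_ends' q.eda]
        generalize (if v = a then (1 : ZMod 2) else 0) = x
        generalize (if v = b then (1 : ZMod 2) else 0) = u
        generalize (if v = y then (1 : ZMod 2) else 0) = z
        generalize (if v = d then (1 : ZMod 2) else 0) = w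
        revert x u z w; decide
    · apply fin (P ∆ {da}) (((R ∆ {ab}) ∆ {da}) ∆ {cd}) (X2 ∆ {ab, bc, cd, da})
        (sE hPE (hsing _ hm.2.2.2))
        (sE (sE (sE hTPE (hsing _ hm.1)) (hsing _ hm.2.2.2)) (hsing _ hm.2.2.1))
        (sE (hsE _ (by simp)) q.subQ) ?_ ?_ (Ev.symmDiff (hev _ (by simp)) q.evQ)
      · intro f f1 f2 f3 f4
        have := hgen f f1 f2 f3 f4
        simp only [Set.mem_symmDiff, Set.mem_insert_iff, Set.mem_singleton_iff, f1, f2, f3, f4, not_false_eq_true, and_true, false_and, or_false]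
        omega
      · simp [Set.mem_symmDiff, nab, hPab, hPbc, hPcd, hPda, hTPab, hTPbc, hTPcd, hTPda, hX2ab, hX2bc, hX2cd, hX2da]
      · simp [Set.mem_symmDiff, nab, hPab, hPbc, hPcd, hPda, hTPab, hTPbc, hTPcd, hTPda, hX2ab, hX2bc, hX2cd, hX2da]
      · simp [Set.mem_symmDiff, nab, hPab, hPbc, hPcd, hPda, hTPab, hTPbc, hTPcd, hTPda, hX2ab, hX2bc, hX2cd, hX2da]
      · simp [Set.mem_symmDiff, nab, hPab, hPbc, hPcd, hPda, hTPab, hTPbc, hTPcd, hTPda, hX2ab, hX2bc, hX2cd, hX2da]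
      · rw [ev_iff]; intro v
        simp only [par_symmDiff, hpP, par_ends' q.ebc, par_ends' q.ecd, par_ends' q.eda]
        generalize (if v = a then (1 : ZMod 2) else 0) = x
        generalize (if v = b then (1 : ZMod 2) else 0) = u
        generalize (if v = c then (1 : ZMod 2) else 0) = z
        generalize (if v = y then (1 : ZMod 2) else 0) = w
        revert x u z w; decide
      · rw [ev_iff]; intro v
        simp only [par_symmDiff, hpTP, hpT, hpP, par_ends' q.eab, par_ends' q.ecd, par_ends' q.eda]
        generalize (if v = a then (1 : ZMod 2) else 0) = x
        generalize (if v = b then (1 : ZMod 2) else 0) = u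
        generalize (if v = c then (1 : ZMod 2) else 0) = z
        generalize (if v = y then (1 : ZMod 2) else 0) = w
        revert x u z w; decide
  · rw [if_neg hbcX1] at cbc
    obtain ⟨Y, D3, rfl, hYbc⟩ := cov_pos (D := D2) (e := bc) (by omega)
    have hYda : da ∉ Y := cov_zero_iff.1 zD2da Y (by simp)
    have hYab : ab ∉ Y := cov_zero_iff.1 zD2ab Y (by simp)
    have hYcd : cd ∉ Y := cov_zero_iff.1 zD2cd Y (by simp)
    apply h.bad
    refine ⟨(X2 ∆ {ab, bc, cd, da}) ::ₘ X1 ::ₘ (Y ∆ {ab, bc, cd, da}) ::ₘ D3, ?_, ?_⟩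
    · intro S hS
      simp only [Multiset.mem_cons] at hS hsE hev
      rcases hS with rfl | rfl | rfl | hS
      · exact ⟨symmDiff_sub (hsE _ (by simp)) q.subQ, (hev _ (by simp)).symmDiff q.evQ⟩
      · exact ⟨hsE _ (by simp), hev _ (by simp)⟩
      · exact ⟨symmDiff_sub (hsE _ (by simp)) q.subQ, (hev _ (by simp)).symmDiff q.evQ⟩
      · exact ⟨hsE S (by simp [hS]), hev S (by simp [hS])⟩
    · have z1 : cov D3 da = 0 := by rw [cov_cons] at zD2da; omega
      have z2 : cov D3 ab = 0 := by rw [cov_cons] at zD2ab; omega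
      have z3 : cov D3 cd = 0 := by rw [cov_cons] at zD2cd; omega
      have z4 : cov D3 bc = 0 := by rw [cov_cons, if_pos hYbc] at cbc; omega
      have nab : ab ≠ bc ∧ ab ≠ cd ∧ ab ≠ da ∧ bc ≠ ab ∧ bc ≠ cd ∧ bc ≠ da ∧ cd ≠ ab ∧ cd ≠ bc ∧ cd ≠ da ∧
        da ≠ ab ∧ da ≠ bc ∧ da ≠ cd := by grind
      intro e he
      simp only [cov_cons]
      by_cases e1 : e = ab
      · subst e1; simp [Set.mem_symmDiff, nab, hX2ab, hX1ab, hYab, z2, hab]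
      by_cases e2 : e = bc
      · subst e2; simp [Set.mem_symmDiff, nab, hX2bc, hbcX1, hYbc, z4, hbc]
      by_cases e3 : e = cd
      · subst e3; simp [Set.mem_symmDiff, nab, hX2cd, hX1cd, hYcd, z3, hcd]
      by_cases e4 : e = da
      · subst e4; simp [Set.mem_symmDiff, nab, hX2da, hX1da, hYda, z1, hda]
      have h2 := hcov' e he e3
      simp only [cov_cons] at h2
      simpa [Set.mem_symmDiff, e1, e2, e3, e4] using h2

lemma Quad.false (q : Quad M a b c d ab bc cd da pa pb pc pd) (h : Mini M C) : False := by
  have a1 := q.case_opp h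
  have a2 := q.rot.case_opp h
  have b1 := q.case_three h
  have b2 := q.rot.case_three h
  have b3 := q.rot.rot.case_three h
  have b4 := q.rot.rot.rot.case_three h
  have c1 := q.case_adj h
  have c2 := q.rot.case_adj h
  have c3 := q.rot.rot.case_adj h
  have c4 := q.rot.rot.rot.case_adj h
  have d1 := q.case_all h
  clear q h
  generalize (ab ∈ C) = p1 at *
  generalize (bc ∈ C) = p2 at *
  generalize (cd ∈ C) = p3 at *
  generalize (da ∈ C) = p4 at *
  by_cases h1 : p1 <;> by_cases h2 : p2 <;> by_cases h3 : p3 <;> by_cases h4 : p4 <;>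
    simp only [h1, h2, h3, h4, not_true_eq_false, not_false_eq_true, and_self, and_true, and_false,
      true_and, false_and] at *

end MG

namespace MG
variable {W : Type} [Fintype W]

/-- the multigraph of a simple graph -/
noncomputable def ofGraph (G : SimpleGraph W) : MG W (Sym2 W) :=
  ⟨fun e => (Quot.out e).1, fun e => (Quot.out e).2, G.edgeSet⟩

variable {G : SimpleGraph W}

lemma ends_of (e : Sym2 W) : (ofGraph G).ends e = e := by
  have : Quot.mk _ (Quot.out e) = e := Quot.out_eq e
  conv_rhs => rw [← this]
  rfl

lemma rep_of (G : SimpleGraph W) : Rep (ofGraph G) G where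
  inj := by
    intro e _ f _ h
    rwa [ends_of, ends_of] at h
  img := by
    intro x y
    simp only [ends_of]
    constructor
    · intro h; exact ⟨s(x, y), h, rfl⟩
    · rintro ⟨e, he, rfl⟩; exact he

lemma edgesOf_of (K : G.Subgraph) : (ofGraph G).edgesOf K = K.edgeSet := by
  ext e
  constructor
  · rintro ⟨_, h⟩; rwa [ends_of] at h
  · intro h; exact ⟨K.edgeSet_subset h, by rwa [ends_of]⟩

lemma mini_of {C : G.Subgraph} (hbridgeless : ∀ e, ¬ G.IsBridge e) (hC : IsCycleSub C)
    (hnoCDC : ¬ ∃ D : Multiset G.Subgraph, IsCDC G D ∧ C ∈ D)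
    (hmin : MinHyp (Fintype.card W) G.edgeSet.ncard) : Mini (ofGraph G) C.edgeSet where
  lpl := (rep_of G).lpl
  brl := (rep_of G).brl hbridgeless
  inj := (rep_of G).inj
  circ := by rw [← edgesOf_of]; exact (rep_of G).circ hC
  ne := by
    obtain ⟨v, hv⟩ := hC.1.nonempty
    have h2 := hC.2 v hv
    obtain ⟨w, hw⟩ := Set.nonempty_of_ncard_ne_zero (s := C.neighborSet v) (by omega)
    exact ⟨s(v, w), hw⟩
  bad := by
    intro hg
    rw [← edgesOf_of] at hg
    exact hnoCDC ((rep_of G).cdc_of_good hC hg)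
  small := by
    intro W' _ M' h1 h2 h3 C' h4
    exact transfer hmin _ W' M' le_rfl h1 h2 (Or.inl h3) C' h4
  small' := by
    intro M' h1 h2 h3 C' h4
    refine transfer hmin _ W M' le_rfl h1 h2 (Or.inr ⟨rfl, ?_⟩) C' h4
    have h5 : (M'.ends '' M'.E).ncard ≤ M'.E.ncard := Set.ncard_image_le (Set.toFinite _)
    have h6 : (ofGraph G).E.ncard = G.edgeSet.ncard := rfl
    omega

lemma mem_cutv {v : W} {e : Sym2 W} : e ∈ (ofGraph G).cut {v} ↔ ∃ w, G.Adj v w ∧ e = s(v, w) := by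
  constructor
  · intro h
    obtain ⟨x, _, h2⟩ := exists_other (rep_of G).lpl h
    rw [ends_of] at h2
    subst h2
    exact ⟨x, h.1, rfl⟩
  · rintro ⟨w, hw, rfl⟩
    refine ⟨hw, ?_⟩
    rw [mem_cr_ends (ends_of _)]
    have := hw.ne
    simp [this.symm]

lemma cut_of (A : Set W) : (ofGraph G).cut A = cutEdges G A := by
  ext e
  induction e using Sym2.ind with
  | _ x y =>
  constructor
  · rintro ⟨h1, h2⟩
    refine ⟨h1, ?_⟩
    rw [mem_cr_ends (ends_of _)] at h2
    by_cases hx : x ∈ A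
    · exact ⟨x, hx, y, by tauto, rfl⟩
    · exact ⟨y, by tauto, x, hx, Sym2.eq_swap⟩
  · rintro ⟨h1, u, hu, w, hw, h2⟩
    refine ⟨h1, ?_⟩
    rw [mem_cr_ends ((ends_of _).trans h2)]
    tauto

variable {C : Set (Sym2 W)}

lemma cubic_of (h : Mini (ofGraph G) C) (v : W) : (G.neighborSet v).ncard = 3 := by
  rw [← (rep_of G).deg_top]; exact h.cubic v

lemma third {v b d : W} (h : (G.neighborSet v).ncard = 3) (hb : G.Adj v b) (hd : G.Adj v d) (hbd : b ≠ d) :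
    ∃ x, x ≠ b ∧ x ≠ d ∧ G.Adj v x ∧ ∀ y, G.Adj v y → y = b ∨ y = d ∨ y = x := by
  obtain ⟨x, y, z, h1, h2, h3, h4⟩ := Set.ncard_eq_three.1 h
  have h5 : ∀ u, G.Adj v u ↔ u = x ∨ u = y ∨ u = z := by
    intro u
    have : u ∈ G.neighborSet v ↔ u ∈ ({x, y, z} : Set W) := by rw [h4]
    simpa using this
  rw [h5] at hb hd
  simp only [h5]
  rcases hb with rfl | rfl | rfl <;> rcases hd with rfl | rfl | rfl
  · exact absurd rfl hbd
  · exact ⟨z, by grind, by grind, by grind, by grind⟩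
  · exact ⟨y, by grind, by grind, by grind, by grind⟩
  · exact ⟨z, by grind, by grind, by grind, by grind⟩
  · exact absurd rfl hbd
  · exact ⟨x, by grind, by grind, by grind, by grind⟩
  · exact ⟨y, by grind, by grind, by grind, by grind⟩
  · exact ⟨x, by grind, by grind, by grind, by grind⟩
  · exact absurd rfl hbd

lemma no_tri (h : Mini (ofGraph G) C) {a b c : W} (hab : G.Adj a b) (hbc : G.Adj b c) (hca : G.Adj c a) :
    False := by
  have nab := hab.ne
  have nbc := hbc.ne
  have nca := hca.ne
  obtain ⟨x, hx1, hx2, hx, hx'⟩ := third (cubic_of h a) hab hca.symm nbc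
  obtain ⟨y, hy1, hy2, hy, hy'⟩ := third (cubic_of h b) hbc hab.symm nca
  obtain ⟨z, hz1, hz2, hz, hz'⟩ := third (cubic_of h c) hca hbc.symm nab
  set A : Set W := {a, b, c} with hA
  have mA : ∀ u, u ∈ A ↔ u = a ∨ u = b ∨ u = c := fun u => Iff.rfl
  have hsub : (ofGraph G).cut A ⊆ {s(a, x), s(b, y), s(c, z)} := by
    rw [cut_of]
    rintro e ⟨he, u, hu, w, hw, rfl⟩
    have he' : G.Adj u w := he
    rw [mA] at hu hw
    push Not at hw
    rcases hu with rfl | rfl | rfl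
    · rcases hx' w he' with h1 | h1 | h1
      · exact absurd h1 hw.2.1
      · exact absurd h1 hw.2.2
      · subst h1; simp
    · rcases hy' w he' with h1 | h1 | h1
      · exact absurd h1 hw.2.2
      · exact absurd h1 hw.1
      · subst h1; simp
    · rcases hz' w he' with h1 | h1 | h1
      · exact absurd h1 hw.1
      · exact absurd h1 hw.2.1
      · subst h1; simp
  have hc3 : ((ofGraph G).cut A).ncard ≤ 3 := by
    refine (Set.ncard_le_ncard hsub).trans ?_
    have e1 := Set.ncard_insert_le s(a, x) ({s(b, y), s(c, z)} : Set (Sym2 W))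
    have e2 := Set.ncard_insert_le s(b, y) ({s(c, z)} : Set (Sym2 W))
    rw [Set.ncard_singleton] at e2
    omega
  have hxa := hx.ne
  obtain ⟨w, hw | hw⟩ := h.small_cut (X := A) ⟨a, by simp [hA]⟩ ⟨x, by
    simp only [Set.mem_compl_iff, mA]; grind⟩ hc3
  · have h1 : a ∈ A := by simp [hA]
    have h2 : b ∈ A := by simp [hA]
    rw [hw] at h1 h2
    exact nab (h1.trans h2.symm)
  · have hall : ∀ u, u = a ∨ u = b ∨ u = c ∨ u = w := by
      intro u
      by_cases hu : u ∈ A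
      · rw [mA] at hu; tauto
      · have : u ∈ Aᶜ := hu
        rw [hw] at this
        exact Or.inr (Or.inr (Or.inr this))
    have hwA : w ∈ Aᶜ := by rw [hw]; rfl
    simp only [Set.mem_compl_iff, mA, not_or] at hwA
    obtain ⟨w1, w2, w3⟩ := hwA
    obtain ⟨v, e1, he1, e2, he2, hne, hcol⟩ := h.uncol (fun e =>
      if e = s(a, b) ∨ e = s(c, w) then 0 else if e = s(a, c) ∨ e = s(b, w) then 1 else 2)
    rw [mem_cutv] at he1 he2
    obtain ⟨p, hp, rfl⟩ := he1
    obtain ⟨r, hr, rfl⟩ := he2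
    have hp' := hp.ne
    have hr' := hr.ne
    have hpr : p ≠ r := by rintro rfl; exact hne rfl
    clear hp hr hne hw hc3 hsub hx' hy' hz' hx hy hz
    rcases hall v with rfl | rfl | rfl | rfl <;> rcases hall p with rfl | rfl | rfl | rfl <;>
      rcases hall r with rfl | rfl | rfl | rfl <;>
      first
      | exact absurd rfl hpr
      | exact absurd rfl hp'
      | exact absurd rfl hr'
      | (simp [Sym2.eq_iff, *] at hcol; done)
      | (simp [Sym2.eq_iff, *, Ne.symm w1, Ne.symm w2, Ne.symm w3, nab, nbc, nca, nab.symm, nbc.symm, nca.symm] at hcol; done)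

lemma no_quad (h : Mini (ofGraph G) C) {a b c d : W} (hab : G.Adj a b) (hbc : G.Adj b c) (hcd : G.Adj c d)
    (hda : G.Adj d a) (nac : a ≠ c) (nbd : b ≠ d) : False := by
  have nab := hab.ne
  have nbc := hbc.ne
  have ncd := hcd.ne
  have nda := hda.ne
  have hac : ¬ G.Adj a c := fun h1 => no_tri h hab hbc h1.symm
  have hbd : ¬ G.Adj b d := fun h1 => no_tri h hbc hcd h1.symm
  obtain ⟨x, hx1, hx2, hx, hx'⟩ := third (cubic_of h a) hab hda.symm nbd
  obtain ⟨y, hy1, hy2, hy, hy'⟩ := third (cubic_of h b) hbc hab.symm nac.symm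
  obtain ⟨z, hz1, hz2, hz, hz'⟩ := third (cubic_of h c) hcd hbc.symm nbd.symm
  obtain ⟨t, ht1, ht2, ht, ht'⟩ := third (cubic_of h d) hda hcd.symm nac
  have x3 : x ≠ c := by rintro rfl; exact hac hx
  have y3 : y ≠ d := by rintro rfl; exact hbd hy
  have z3 : z ≠ a := by rintro rfl; exact hac hz.symm
  have t3 : t ≠ b := by rintro rfl; exact hbd ht.symm
  have x4 := hx.ne
  have y4 := hy.ne
  have z4 := hz.ne
  have t4 := ht.ne
  have q : Quad (ofGraph G) a b c d s(a, b) s(b, c) s(c, d) s(d, a) s(a, x) s(b, y) s(c, z) s(d, t) := by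
    refine ⟨?_, ?_, ?_, ?_, nab, nac, nda.symm, nbc, nbd, ncd, ends_of _, ends_of _, ends_of _, ends_of _, ?_⟩
    · ext e
      rw [mem_cutv]
      constructor
      · rintro ⟨w, hw, rfl⟩
        rcases hx' w hw with rfl | rfl | rfl <;> simp
      · rintro (rfl | rfl | rfl)
        · exact ⟨_, hab, rfl⟩
        · exact ⟨_, hda.symm, Sym2.eq_swap⟩
        · exact ⟨_, hx, rfl⟩
    · ext e
      rw [mem_cutv]
      constructor
      · rintro ⟨w, hw, rfl⟩
        rcases hy' w hw with rfl | rfl | rfl <;> simp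
      · rintro (rfl | rfl | rfl)
        · exact ⟨_, hbc, rfl⟩
        · exact ⟨_, hab.symm, Sym2.eq_swap⟩
        · exact ⟨_, hy, rfl⟩
    · ext e
      rw [mem_cutv]
      constructor
      · rintro ⟨w, hw, rfl⟩
        rcases hz' w hw with rfl | rfl | rfl <;> simp
      · rintro (rfl | rfl | rfl)
        · exact ⟨_, hcd, rfl⟩
        · exact ⟨_, hbc.symm, Sym2.eq_swap⟩
        · exact ⟨_, hz, rfl⟩
    · ext e
      rw [mem_cutv]
      constructor
      · rintro ⟨w, hw, rfl⟩
        rcases ht' w hw with rfl | rfl | rfl <;> simp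
      · rintro (rfl | rfl | rfl)
        · exact ⟨_, hda, rfl⟩
        · exact ⟨_, hcd.symm, Sym2.eq_swap⟩
        · exact ⟨_, ht, rfl⟩
    · clear hx' hy' hz' ht' hab hbc hcd hda hx hy hz ht hac hbd
      simp only [List.nodup_cons, List.mem_cons, List.not_mem_nil, or_false, not_or, Sym2.eq_iff,
        List.nodup_nil, not_false_eq_true, and_true]
      refine ⟨⟨?_, ?_, ?_, ?_, ?_, ?_, ?_⟩, ⟨?_, ?_, ?_, ?_, ?_, ?_⟩, ⟨?_, ?_, ?_, ?_, ?_⟩, ⟨?_, ?_, ?_, ?_⟩,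
        ⟨?_, ?_, ?_⟩, ⟨?_, ?_⟩, ?_⟩ <;> grind
  exact q.false h

lemma girth_of (h : Mini (ofGraph G) C) (hac : ¬ G.IsAcyclic) : 5 ≤ G.girth := by
  obtain ⟨a, w, hw, hl⟩ := SimpleGraph.exists_girth_eq_length.2 hac
  have h3 := SimpleGraph.three_le_girth hac
  by_contra hcon
  have h4 : w.length = 3 ∨ w.length = 4 := by omega
  have hnd := hw.support_nodup
  rcases h4 with h4 | h4
  · match w, h4 with
    | .cons h1 (.cons h2 (.cons h3 .nil)), _ => exact no_tri h h1 h2 h3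
  · match w, h4, hnd with
    | .cons h1 (.cons h2 (.cons h3 (.cons h4 .nil))), _, hnd =>
      simp at hnd
      exact no_quad h h1 h2 h3 h4 (by grind) (by grind)

lemma two_le_of_cycle {A : Set W} (h : HasCycleIn G A) : 2 ≤ A.ncard := by
  obtain ⟨K, hK, hKA⟩ := h
  obtain ⟨v, hv⟩ := hK.1.nonempty
  rw [← hK.2 v hv]
  exact Set.ncard_le_ncard (fun u hu => hKA (K.edge_vert (SimpleGraph.Subgraph.Adj.symm hu)))

lemma vert_iff {K : G.Subgraph} (hK : IsCycleSub K) (v : W) :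
    v ∈ K.verts ↔ (K.edgeSet ∩ (ofGraph G).cr {v}).Nonempty := by
  have h1 := (rep_of G).deg K v
  rw [edgesOf_of] at h1
  rw [← Set.ncard_pos (Set.toFinite _), h1]
  constructor
  · intro hv; rw [hK.2 v hv]; omega
  · intro h
    obtain ⟨w, hw⟩ := Set.nonempty_of_ncard_ne_zero (s := K.neighborSet v) (by omega)
    exact K.edge_vert hw

end MG
open MG

/-- a minimal counterexample (G, C) to the strong cycle double cover
conjecture is a snark together with a stable cycle. -/
theorem minimal_scdcc_counterexample_is_snark_with_stable_cycle
    {V : Type} [Fintype V] (G : SimpleGraph V)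
    (hbridgeless : ∀ e, ¬ G.IsBridge e)
    (C : G.Subgraph) (hC : IsCycleSub C)
    (hnoCDC : ¬ ∃ D : Multiset G.Subgraph, IsCDC G D ∧ C ∈ D)
    (hmin : ∀ (W : Type) [Fintype W] (H : SimpleGraph W),
      (∀ e, ¬ H.IsBridge e) →
      (Fintype.card W < Fintype.card V ∨
        (Fintype.card W = Fintype.card V ∧ H.edgeSet.ncard < G.edgeSet.ncard)) →
      ∀ C' : H.Subgraph, IsCycleSub C' →
        ∃ D : Multiset H.Subgraph, IsCDC H D ∧ C' ∈ D) :
    IsSnark G ∧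
      ¬ ∃ C' : G.Subgraph, IsCycleSub C' ∧ C' ≠ C ∧ C.verts ⊆ C'.verts := by
  have h := mini_of hbridgeless hC hnoCDC hmin
  refine ⟨⟨cubic_of h, ?_, ?_, girth_of h ?_⟩, ?_⟩
  · rintro ⟨c, hc⟩
    obtain ⟨v, e1, he1, e2, he2, hne, hcol⟩ := h.uncol c
    refine hc e1 he1.1 e2 he2.1 hne ⟨v, ?_, ?_⟩ hcol
    · obtain ⟨w, _, rfl⟩ := mem_cutv.1 he1; simp
    · obtain ⟨w, _, rfl⟩ := mem_cutv.1 he2; simp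
  · intro A hA hA'
    rw [← cut_of]
    exact h.cut3 (two_le_of_cycle hA) (two_le_of_cycle hA')
  · intro hac
    obtain ⟨e, he⟩ := h.ne
    exact hbridgeless e (SimpleGraph.isAcyclic_iff_forall_edge_isBridge.1 hac (C.edgeSet_subset he))
  · rintro ⟨C', hC', hne, hv⟩
    apply hne
    have hcirc : (ofGraph G).Circ C'.edgeSet := by
      rw [← edgesOf_of]; exact (rep_of G).circ hC'
    have heq := h.stable hcirc (fun v hv1 => (vert_iff hC' v).1 (hv ((vert_iff hC v).2 hv1)))
    apply SimpleGraph.Subgraph.ext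
    · ext v
      rw [vert_iff hC', vert_iff hC, heq]
    · ext x y
      rw [← SimpleGraph.Subgraph.mem_edgeSet, heq, SimpleGraph.Subgraph.mem_edgeSet]



end SnarkPaper
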